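/- Let Assumption A hold with γ as in (C1). If the switched system ẋ = f(t,x,u,σ) is 0-GUAS w.r.t. S and 0-OD w.r.t. S with supply function α ∈ K, then the system is iISS w.r.t. S with iISS gain χ = max{α, γ} and is χ-BEICS w.r.t. S. -/

import Mathlib

open MeasureTheory Set Filter Topology

noncomputable section

/-- A class-`K` function: continuous and strictly increasing on `[0,∞)` with `φ 0 = 0`. -/
def ClassK (φ : ℝ → ℝ) : Prop :=
  ContinuousOn φ (Set.Ici 0) ∧ StrictMonoOn φ (Set.Ici 0) ∧ φ 0 = 0

/-- A class-`K∞` function: class `K` and unbounded. -/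
def ClassKInf (φ : ℝ → ℝ) : Prop :=
  ClassK φ ∧ Filter.Tendsto φ Filter.atTop Filter.atTop

/-- A class-`KL` function: `β (·, t)` is of class `K∞` for each `t ≥ 0` and `β (r, ·)`
decreases monotonically to `0` for each fixed `r ≥ 0`. -/
def ClassKL (β : ℝ → ℝ → ℝ) : Prop :=
  (∀ t, 0 ≤ t → ClassKInf fun r => β r t) ∧
  (∀ r, 0 ≤ r → AntitoneOn (fun t => β r t) (Set.Ici 0) ∧
    Filter.Tendsto (fun t => β r t) Filter.atTop (nhds 0))

/-- A continuous positive definite function on `[0,∞)`. -/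
def PosDefFun (φ : ℝ → ℝ) : Prop :=
  ContinuousOn φ (Set.Ici 0) ∧ φ 0 = 0 ∧ ∀ s, 0 < s → 0 < φ s

variable {Γ : Type*} {E : Type*} {F : Type*} {P : Type*}
  [NormedAddCommGroup E] [NormedSpace ℝ E]
  [NormedAddCommGroup F] [NormedSpace ℝ F]
  [NormedAddCommGroup P]
  [MeasurableSpace E] [MeasurableSpace F] [MeasurableSpace P]

/-- A switching signal: piecewise constant with finitely many discontinuities on every
bounded interval of `[0,∞)`, and right-continuous. -/
def IsSwitchingSignal (σ : ℝ → Γ) : Prop :=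
  ∀ b : ℝ, 0 < b → ∃ (n : ℕ) (t : ℕ → ℝ), t 0 = 0 ∧ (∀ i < n, t i < t (i + 1)) ∧ b ≤ t n ∧
    ∀ i < n, ∀ s ∈ Set.Ico (t i) (t (i + 1)), σ s = σ (t i)

/-- An admissible input: Lebesgue measurable and locally essentially bounded. -/
def IsInput (u : ℝ → F) : Prop :=
  Measurable u ∧ ∀ b : ℝ, ∃ C : ℝ, ∀ᵐ s ∂volume, s ∈ Set.Icc (0 : ℝ) b → ‖u s‖ ≤ C

/-- A Carathéodory solution of `ẋ = f t x u σ` on the domain `D ⊆ [0,∞)` (an interval):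
a continuous function satisfying the corresponding integral equation. -/
structure IsSolution (f : ℝ → E → F → Γ → E) (u : ℝ → F) (σ : ℝ → Γ)
    (D : Set ℝ) (x : ℝ → E) : Prop where
  ordConnected : D.OrdConnected
  subset_Ici : D ⊆ Set.Ici 0
  nonempty : D.Nonempty
  continuousOn : ContinuousOn x D
  intervalIntegrable : ∀ a ∈ D, ∀ b ∈ D,
    IntervalIntegrable (fun s => f s (x s) (u s) (σ s)) volume a b
  integral_eq : ∀ a ∈ D, ∀ b ∈ D, x b = x a + ∫ s in a..b, f s (x s) (u s) (σ s)

/-- A maximally defined Carathéodory solution: one admitting no proper extension. -/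
def IsMaximalSolution (f : ℝ → E → F → Γ → E) (u : ℝ → F) (σ : ℝ → Γ)
    (D : Set ℝ) (x : ℝ → E) : Prop :=
  IsSolution f u σ D x ∧
    ∀ D' : Set ℝ, ∀ x' : ℝ → E, IsSolution f u σ D' x' → D ⊆ D' → Set.EqOn x x' D → D' ⊆ D

/-- Standing regularity assumptions on `f`: vanishing at the origin for zero input,
Lebesgue measurable in `t`, continuous in `(ξ, μ)`. -/
def Regular (f : ℝ → E → F → Γ → E) : Prop :=
  (∀ t, 0 ≤ t → ∀ i, f t 0 0 i = 0) ∧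
  (∀ ξ μ i, Measurable fun t => f t ξ μ i) ∧
  (∀ t i, Continuous fun q : E × F => f t q.1 q.2 i)

/-- Forward completeness w.r.t. `S`. -/
def ForwardComplete (f : ℝ → E → F → Γ → E) (S : Set (ℝ → Γ)) : Prop :=
  ∀ t₀, 0 ≤ t₀ → ∀ u : ℝ → F, IsInput u → ∀ σ ∈ S, ∀ D x,
    IsMaximalSolution f u σ D x → t₀ ∈ D → Set.Ici t₀ ⊆ D

/-- iISS w.r.t. `S` with iISS gain `χ`. -/
def IISS (f : ℝ → E → F → Γ → E) (S : Set (ℝ → Γ)) (χ : ℝ → ℝ) : Prop :=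
  ForwardComplete f S ∧
  ∃ β ρ, ClassKL β ∧ ClassK ρ ∧
    ∀ t₀, 0 ≤ t₀ → ∀ u : ℝ → F, IsInput u → ∀ σ ∈ S, ∀ D x,
      IsMaximalSolution f u σ D x → t₀ ∈ D → ∀ t ∈ D, t₀ ≤ t →
        ‖x t‖ ≤ β ‖x t₀‖ (t - t₀) + ρ (∫ s in t₀..t, χ ‖u s‖)

/-- 0-GUAS w.r.t. `S`. -/
def ZeroGUAS (f : ℝ → E → F → Γ → E) (S : Set (ℝ → Γ)) : Prop :=
  ∃ β, ClassKL β ∧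
    ∀ t₀, 0 ≤ t₀ → ∀ σ ∈ S, ∀ D x,
      IsMaximalSolution f (fun _ => (0 : F)) σ D x → t₀ ∈ D → ∀ t ∈ D, t₀ ≤ t →
        ‖x t‖ ≤ β ‖x t₀‖ (t - t₀)

/-- UBEBS w.r.t. `S` with UBEBS gain `α`. -/
def UBEBS (f : ℝ → E → F → Γ → E) (S : Set (ℝ → Γ)) (α : ℝ → ℝ) : Prop :=
  ∃ α₁ α₂ c, ClassK α₁ ∧ ClassK α₂ ∧ 0 ≤ c ∧
    ∀ t₀, 0 ≤ t₀ → ∀ u : ℝ → F, IsInput u → ∀ σ ∈ S, ∀ D x,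
      IsMaximalSolution f u σ D x → t₀ ∈ D → ∀ t ∈ D, t₀ ≤ t →
        ‖x t‖ ≤ α₁ ‖x t₀‖ + α₂ (∫ s in t₀..t, α ‖u s‖) + c

/-- The total `χ`-energy `∫_0^∞ χ(|u(s)|) ds` of an input, as an extended nonnegative real. -/
def Energy (χ : ℝ → ℝ) (u : ℝ → F) : ENNReal :=
  ∫⁻ s in Set.Ioi (0 : ℝ), ENNReal.ofReal (χ ‖u s‖)

/-- `χ`-BEICS w.r.t. `S`: every solution corresponding to an input of finite `χ`-energy
is defined for all future times and converges to `0`. -/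
def BEICS (f : ℝ → E → F → Γ → E) (S : Set (ℝ → Γ)) (χ : ℝ → ℝ) : Prop :=
  ∀ t₀, 0 ≤ t₀ → ∀ u : ℝ → F, IsInput u → ∀ σ ∈ S, ∀ D x,
    IsMaximalSolution f u σ D x → t₀ ∈ D → Energy χ u ≠ ⊤ →
      Set.Ici t₀ ⊆ D ∧ Filter.Tendsto x Filter.atTop (nhds 0)

/-- Condition (C1) of Assumption A, with the class-`K` function `γ`. -/
def CondC1 (f : ℝ → E → F → Γ → E) (γ : ℝ → ℝ) : Prop :=
  ∃ N : ℝ → ℝ, (∀ r, 0 ≤ r → 0 < N r) ∧ MonotoneOn N (Set.Ici 0) ∧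
    ∀ t, 0 ≤ t → ∀ (ξ : E) (μ : F) (i : Γ), ‖f t ξ μ i‖ ≤ N ‖ξ‖ * (1 + γ ‖μ‖)

/-- Condition (C2) of Assumption A. -/
def CondC2 (f : ℝ → E → F → Γ → E) : Prop :=
  ∀ r, 0 < r → ∀ ε, 0 < ε → ∃ δ, 0 < δ ∧ ∀ t, 0 ≤ t → ∀ (i : Γ) (ξ : E) (μ : F),
    ‖ξ‖ ≤ r → ‖μ‖ ≤ δ → ‖f t ξ μ i - f t ξ 0 i‖ < ε

/-- Condition (C3) of Assumption A: `f (t, ξ, 0, i)` is locally Lipschitz in `ξ`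
uniformly in `t` and `i`. -/
def CondC3 (f : ℝ → E → F → Γ → E) : Prop :=
  ∀ K : Set E, IsCompact K → ∃ L, 0 ≤ L ∧ ∀ t, 0 ≤ t → ∀ (i : Γ), ∀ ξ ∈ K, ∀ ξ' ∈ K,
    ‖f t ξ 0 i - f t ξ' 0 i‖ ≤ L * ‖ξ - ξ'‖

/-- Assumption A, with `γ` the class-`K` function appearing in (C1). -/
def AssumptionA (f : ℝ → E → F → Γ → E) (γ : ℝ → ℝ) : Prop :=
  ClassK γ ∧ CondC1 f γ ∧ CondC2 f ∧ CondC3 f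

/-- Sandwich bounds `φ₁(|ξ|) ≤ V(t,ξ) ≤ φ₂(|ξ|)` with `φ₁, φ₂` of class `K∞`. -/
def StorageBounds (V : ℝ → E → ℝ) : Prop :=
  ∃ φ₁ φ₂, ClassKInf φ₁ ∧ ClassKInf φ₂ ∧
    ∀ t, 0 ≤ t → ∀ ξ : E, φ₁ ‖ξ‖ ≤ V t ξ ∧ V t ξ ≤ φ₂ ‖ξ‖

/-- 0-OD (zero-output dissipativity) w.r.t. `S` witnessed by the storage function `V`
and the supply function `α`. -/
def ZeroODWithStorage (f : ℝ → E → F → Γ → E) (S : Set (ℝ → Γ)) (V : ℝ → E → ℝ)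
    (α : ℝ → ℝ) : Prop :=
  StorageBounds V ∧
    ∀ t₀, 0 ≤ t₀ → ∀ u : ℝ → F, IsInput u → ∀ σ ∈ S, ∀ D x,
      IsMaximalSolution f u σ D x → t₀ ∈ D → ∀ t ∈ D, t₀ ≤ t →
        V t (x t) ≤ V t₀ (x t₀) + ∫ s in t₀..t, α ‖u s‖

/-- 0-OD w.r.t. `S` with supply function `α`. -/
def ZeroOD (f : ℝ → E → F → Γ → E) (S : Set (ℝ → Γ)) (α : ℝ → ℝ) : Prop :=
  ∃ V : ℝ → E → ℝ, (∀ t ξ, 0 ≤ V t ξ) ∧ ZeroODWithStorage f S V α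

/-- `h`-OD (output dissipativity) w.r.t. `S` with supply function `α`. -/
def HOD (f : ℝ → E → F → Γ → E) (h : ℝ → E → F → Γ → P) (S : Set (ℝ → Γ))
    (α : ℝ → ℝ) : Prop :=
  ∃ V : ℝ → E → ℝ, (∀ t ξ, 0 ≤ V t ξ) ∧ StorageBounds V ∧
    ∃ α₃, PosDefFun α₃ ∧
      ∀ t₀, 0 ≤ t₀ → ∀ u : ℝ → F, IsInput u → ∀ σ ∈ S, ∀ D x,
        IsMaximalSolution f u σ D x → t₀ ∈ D → ∀ t ∈ D, t₀ ≤ t →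
          V t (x t) ≤ V t₀ (x t₀) - (∫ s in t₀..t, α₃ ‖h s (x s) (u s) (σ s)‖)
            + ∫ s in t₀..t, α ‖u s‖

/-- The pair `(h, f)` is zero-input output-persistently exciting w.r.t. `S`. -/
def OutputPE (f : ℝ → E → F → Γ → E) (h : ℝ → E → F → Γ → P)
    (S : Set (ℝ → Γ)) : Prop :=
  ∀ ε : ℝ, 0 < ε → ε ≤ 1 → ∃ T, 0 < T ∧ ∃ r, 0 < r ∧
    ∀ t₀, 0 ≤ t₀ → ∀ σ ∈ S, ∀ D x,
      IsMaximalSolution f (fun _ => (0 : F)) σ D x → t₀ ∈ D →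
        ∀ t, t₀ ≤ t → Set.Icc t (t + T) ⊆ D →
          (∀ τ ∈ Set.Icc t (t + T), ε ≤ ‖x τ‖ ∧ ‖x τ‖ ≤ 1 / ε) →
            r ≤ ∫ τ in t..(t + T), ‖h τ (x τ) 0 (σ τ)‖ ^ 2

/-- Standing regularity assumptions on the output map `h`. -/
def OutputRegular (h : ℝ → E → F → Γ → P) : Prop :=
  (∀ ξ μ i, Measurable fun t => h t ξ μ i) ∧
  (∀ t i, Continuous fun q : E × F => h t q.1 q.2 i) ∧
  ∀ K : Set E, IsCompact K → (0 : E) ∉ K → ∃ M : ℝ,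
    ∀ᵐ t ∂volume, 0 ≤ t → ∀ ξ ∈ K, ∀ i : Γ, ‖h t ξ 0 i‖ ≤ M

set_option linter.unusedSectionVars false

lemma ClassK.monotoneOn {φ : ℝ → ℝ} (h : ClassK φ) : MonotoneOn φ (Ici 0) := h.2.1.monotoneOn

lemma ClassK.mono {φ : ℝ → ℝ} (h : ClassK φ) {a b : ℝ} (ha : 0 ≤ a) (hab : a ≤ b) : φ a ≤ φ b :=
  h.monotoneOn ha (ha.trans hab) hab

lemma ClassK.nonneg {φ : ℝ → ℝ} (h : ClassK φ) {a : ℝ} (ha : 0 ≤ a) : 0 ≤ φ a := by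
  simpa [h.2.2] using h.mono le_rfl ha

lemma ClassK.pos {φ : ℝ → ℝ} (h : ClassK φ) {a : ℝ} (ha : 0 < a) : 0 < φ a := by
  simpa [h.2.2] using h.2.1 (mem_Ici.2 le_rfl) (mem_Ici.2 ha.le) ha

lemma ClassK.sup {φ ψ : ℝ → ℝ} (h : ClassK φ) (k : ClassK ψ) :
    ClassK fun s => max (φ s) (ψ s) :=
  ⟨h.1.sup k.1, fun _ ha _ hb hab => max_lt_max (h.2.1 ha hb hab) (k.2.1 ha hb hab), by
    simp [h.2.2, k.2.2]⟩

lemma ClassK.add {φ ψ : ℝ → ℝ} (h : ClassK φ) (k : ClassK ψ) : ClassK fun s => φ s + ψ s :=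
  ⟨h.1.add k.1, fun _ ha _ hb hab => add_lt_add (h.2.1 ha hb hab) (k.2.1 ha hb hab), by
    simp [h.2.2, k.2.2]⟩

lemma ClassK.comp {φ ψ : ℝ → ℝ} (h : ClassK φ) (k : ClassK ψ) : ClassK fun s => φ (ψ s) :=
  ⟨h.1.comp k.1 fun _ ha => k.nonneg ha,
    fun _ ha _ hb hab => h.2.1 (k.nonneg ha) (k.nonneg hb) (k.2.1 ha hb hab), by
      simp [h.2.2, k.2.2]⟩

lemma ClassK.const_mul {φ : ℝ → ℝ} (h : ClassK φ) {c : ℝ} (hc : 0 < c) :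
    ClassK fun s => c * φ s :=
  ⟨continuousOn_const.mul h.1, fun _ ha _ hb hab => mul_lt_mul_of_pos_left (h.2.1 ha hb hab) hc, by
    simp [h.2.2]⟩

lemma classK_id : ClassK fun s => s := ⟨continuousOn_id, fun _ _ _ _ h => h, rfl⟩

/-- A class-`K` function is arbitrarily small at some positive argument. -/
lemma ClassK.exists_pos_le {φ : ℝ → ℝ} (h : ClassK φ) {ε : ℝ} (hε : 0 < ε) :
    ∃ δ, 0 < δ ∧ φ δ ≤ ε := by
  have h1 : Tendsto φ (𝓝[Ici 0] 0) (𝓝 (φ 0)) := h.1 0 (mem_Ici.2 le_rfl)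
  rw [h.2.2] at h1
  have h2 : ∀ᶠ s in 𝓝[Ioi 0] (0 : ℝ), φ s < ε :=
    (h1.mono_left (nhdsWithin_mono _ Ioi_subset_Ici_self)).eventually_lt_const hε
  obtain ⟨δ, h3, h4⟩ := (h2.and self_mem_nhdsWithin).exists
  exact ⟨δ, h4, h3.le⟩

/-- A class-`K∞` function has a class-`K` inverse on `[0,∞)`. -/
lemma ClassKInf.exists_inverse {φ : ℝ → ℝ} (h : ClassKInf φ) :
    ∃ g, ClassK g ∧ ∀ s, 0 ≤ s → g (φ s) = s := by
  obtain ⟨hK, hT⟩ := h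
  let e : ℝ → ℝ := fun s => φ (max s 0) + min s 0
  have hmono : StrictMono e := by
    intro a b hab
    rcases lt_or_ge b 0 with hb | hb
    · have ha : a < 0 := hab.trans hb
      simp only [e, max_eq_right hb.le, max_eq_right ha.le, min_eq_left hb.le, min_eq_left ha.le]
      linarith
    · rcases lt_or_ge a 0 with ha | ha
      · simp only [e, max_eq_left hb, max_eq_right ha.le, min_eq_right hb, min_eq_left ha.le, hK.2.2]
        linarith [hK.nonneg hb]
      · simp only [e, max_eq_left hb, max_eq_left ha, min_eq_right hb, min_eq_right ha]
        linarith [hK.2.1 ha hb hab]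
  have hcont : Continuous e :=
    (hK.1.comp_continuous (continuous_id.max continuous_const) fun s => le_max_right s 0).add
      (continuous_id.min continuous_const)
  have hbot : Tendsto e atBot atBot := by
    refine tendsto_id.congr' ?_
    filter_upwards [eventually_le_atBot (0 : ℝ)] with s hs
    simp [e, max_eq_right hs, min_eq_left hs, hK.2.2]
  have htop : Tendsto e atTop atTop := by
    refine hT.congr' ?_
    filter_upwards [eventually_ge_atTop (0 : ℝ)] with s hs
    simp [e, max_eq_left hs, min_eq_right hs]
  let o : ℝ ≃o ℝ := hmono.orderIsoOfSurjective e (hcont.surjective htop hbot)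
  have ho : ∀ s, o s = e s := fun s => rfl
  have key : ∀ s, 0 ≤ s → o.symm (φ s) = s := by
    intro s hs
    rw [o.symm_apply_eq, ho]
    simp [e, max_eq_left hs, min_eq_right hs]
  refine ⟨o.symm, ⟨o.symm.continuous.continuousOn, o.symm.strictMono.strictMonoOn _, ?_⟩, key⟩
  simpa [hK.2.2] using key 0 le_rfl

lemma ClassK.le_add_of_le_add {φ g : ℝ → ℝ} (hg : ClassK g) (hinv : ∀ s, 0 ≤ s → g (φ s) = s)
    (hφ : ClassK φ) {s a b : ℝ} (hs : 0 ≤ s) (ha : 0 ≤ a) (hb : 0 ≤ b) (h : φ s ≤ a + b) :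
    s ≤ g (2 * a) + g (2 * b) := by
  rw [← hinv s hs]
  have h0 := hφ.nonneg hs
  have h1 : 0 ≤ g (2 * a) := hg.nonneg (by positivity)
  have h2 : 0 ≤ g (2 * b) := hg.nonneg (by positivity)
  rcases le_total a b with hab | hab
  · linarith [hg.mono h0 (show φ s ≤ 2 * b by linarith)]
  · linarith [hg.mono h0 (show φ s ≤ 2 * a by linarith)]

/-- A family of triples `(a, τ, v)` (initial size, elapsed time, value) with `v ≤ ψ a` and
`v` uniformly small for large `τ` on bounded sets of `a` is dominated by a class-`KL` function. -/
lemma exists_classKL_bound (A : Set (ℝ × ℝ × ℝ)) {ψ : ℝ → ℝ} (hψ : ClassK ψ)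
    (ha : ∀ p ∈ A, 0 ≤ p.1) (hb : ∀ p ∈ A, p.2.2 ≤ ψ p.1)
    (hT : ∀ r, 0 ≤ r → ∀ ε, 0 < ε → ∃ T, ∀ p ∈ A, p.1 ≤ r → T ≤ p.2.1 → p.2.2 ≤ ε) :
    ∃ β, ClassKL β ∧ ∀ p ∈ A, 0 ≤ p.2.1 → p.2.2 ≤ β p.1 p.2.1 := by
  let B : ℝ → ℝ → Set ℝ := fun r s => insert 0 {v | ∃ p ∈ A, p.1 ≤ r ∧ s ≤ p.2.1 ∧ p.2.2 = v}
  let g : ℝ → ℝ → ℝ := fun r s => sSup (B r s)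
  have hBle : ∀ r s, ∀ v ∈ B r s, v ≤ ψ (max r 0) := by
    rintro r s v (rfl | ⟨p, hp, hpr, -, rfl⟩)
    · exact hψ.nonneg (le_max_right _ _)
    · exact (hb p hp).trans (hψ.mono (ha p hp) (hpr.trans (le_max_left _ _)))
  have hbdd : ∀ r s, BddAbove (B r s) := fun r s => ⟨_, fun v hv => hBle r s v hv⟩
  have hne : ∀ r s, (B r s).Nonempty := fun r s => ⟨0, mem_insert _ _⟩
  have hg0 : ∀ r s, 0 ≤ g r s := fun r s => le_csSup (hbdd r s) (mem_insert _ _)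
  have hgψ : ∀ r s, g r s ≤ ψ (max r 0) := fun r s => csSup_le (hne r s) (hBle r s)
  have hmono : ∀ s, Monotone fun r => g r s := by
    intro s r r' hr
    refine csSup_le_csSup (hbdd _ _) (hne _ _) (insert_subset_insert ?_)
    rintro v ⟨p, hp, h1, h2, h3⟩
    exact ⟨p, hp, h1.trans hr, h2, h3⟩
  have hanti : ∀ r, Antitone fun s => g r s := by
    intro r s s' hs
    refine csSup_le_csSup (hbdd _ _) (hne _ _) (insert_subset_insert ?_)
    rintro v ⟨p, hp, h1, h2, h3⟩
    exact ⟨p, hp, h1, hs.trans h2, h3⟩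
  have hint : ∀ s a b, IntervalIntegrable (fun q => g q s) volume a b :=
    fun s a b => (hmono s).intervalIntegrable
  have hmonoc : ∀ r, 0 ≤ r → ∀ s, Monotone fun v => g (r * v) s :=
    fun r hr s => (hmono s).comp fun _ _ h => mul_le_mul_of_nonneg_left h hr
  let G : ℝ → ℝ → ℝ := fun r s => ∫ v in (1 : ℝ)..2, g (r * v) s
  have hGmono : ∀ s, MonotoneOn (fun r => G r s) (Ici 0) := by
    intro s r hr r' hr' h
    refine intervalIntegral.integral_mono_on (by norm_num) (hmonoc r hr s).intervalIntegrable
      (hmonoc r' hr' s).intervalIntegrable fun v hv => hmono s ?_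
    exact mul_le_mul_of_nonneg_right h (by linarith [hv.1])
  have hGle : ∀ r, 0 ≤ r → ∀ s, G r s ≤ g (r * 2) s := by
    intro r hr s
    have := intervalIntegral.integral_mono_on (μ := volume) (a := 1) (b := 2) (by norm_num)
      (hmonoc r hr s).intervalIntegrable (intervalIntegrable_const (c := g (r * 2) s))
      fun v hv => hmonoc r hr s hv.2
    refine this.trans (le_of_eq ?_)
    norm_num
  have hGge : ∀ r, 0 ≤ r → ∀ s, g r s ≤ G r s := by
    intro r hr s
    have := intervalIntegral.integral_mono_on (μ := volume) (a := 1) (b := 2) (by norm_num)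
      (intervalIntegrable_const (c := g (r * 1) s))
      (hmonoc r hr s).intervalIntegrable fun v hv => hmonoc r hr s hv.1
    refine (le_of_eq ?_).trans this
    norm_num
  have hGanti : ∀ r, 0 ≤ r → Antitone fun s => G r s := by
    intro r hr s s' h
    exact intervalIntegral.integral_mono_on (by norm_num) (hmonoc r hr s').intervalIntegrable
      (hmonoc r hr s).intervalIntegrable fun v _ => hanti _ h
  have hG0 : ∀ s, G 0 s = 0 := by
    intro s
    refine le_antisymm ((hGle 0 le_rfl s).trans ?_) ((hg0 0 s).trans (hGge 0 le_rfl s))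
    simpa [hψ.2.2] using hgψ (0 * 2) s
  have hGcont : ∀ s, ContinuousOn (fun r => G r s) (Ici 0) := by
    intro s r hr
    rcases (mem_Ici.1 hr).eq_or_lt with rfl | hr
    · have h1 : Tendsto (fun r => ψ (r * 2)) (𝓝[Ici 0] 0) (𝓝 0) := by
        have h2 : ContinuousOn (fun r : ℝ => ψ (r * 2)) (Ici 0) :=
          hψ.1.comp (by fun_prop) fun a ha => mem_Ici.2 (mul_nonneg ha (by norm_num))
        simpa [ContinuousWithinAt, hψ.2.2] using h2 0 (mem_Ici.2 le_rfl)
      show Tendsto (fun r => G r s) (𝓝[Ici 0] 0) (𝓝 (G 0 s))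
      rw [hG0]
      refine tendsto_of_tendsto_of_tendsto_of_le_of_le' tendsto_const_nhds h1 ?_ ?_
      · filter_upwards [self_mem_nhdsWithin] with a ha using (hg0 a s).trans (hGge a ha s)
      · filter_upwards [self_mem_nhdsWithin] with a ha
        refine (hGle a ha s).trans ((hgψ _ _).trans (le_of_eq ?_))
        rw [max_eq_left (mul_nonneg ha (by norm_num))]
    · have h1 : Continuous fun b => ∫ q in (0 : ℝ)..b, g q s :=
        intervalIntegral.continuous_primitive (hint s) 0
      have h2 : ContinuousAt (fun r => r⁻¹ *
          ((∫ q in (0 : ℝ)..(r * 2), g q s) - ∫ q in (0 : ℝ)..r, g q s)) r :=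
        (continuousAt_inv₀ hr.ne').mul
          ((h1.comp (continuous_mul_const 2)).sub h1).continuousAt
      refine (h2.congr ?_).continuousWithinAt
      filter_upwards [eventually_gt_nhds hr] with a ha
      have h3 := intervalIntegral.integral_comp_mul_left (a := 1) (b := 2) (fun q => g q s) ha.ne'
      simp only [G, h3, mul_one, smul_eq_mul]
      rw [intervalIntegral.integral_interval_sub_left (hint _ _ _) (hint _ _ _)]
  have hGlim : ∀ r, 0 ≤ r → Tendsto (fun s => G r s) atTop (𝓝 0) := by
    intro r hr
    rw [Metric.tendsto_atTop]
    intro ε hε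
    obtain ⟨T, hT'⟩ := hT (r * 2) (by positivity) (ε / 2) (by positivity)
    refine ⟨T, fun s hs => ?_⟩
    have h1 : 0 ≤ G r s := (hg0 r s).trans (hGge r hr s)
    have h2 : g (r * 2) s ≤ ε / 2 := by
      refine csSup_le (hne _ _) ?_
      rintro v (rfl | ⟨p, hp, h3, h4, rfl⟩)
      · positivity
      · exact hT' p hp h3 (hs.le.trans h4)
    rw [Real.dist_eq, sub_zero, abs_of_nonneg h1]
    linarith [hGle r hr s]
  refine ⟨fun r s => G r s + r * Real.exp (-s), ⟨fun s _ => ⟨⟨?_, ?_, ?_⟩, ?_⟩, fun r hr => ⟨?_, ?_⟩⟩, ?_⟩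
  · exact (hGcont s).add (by fun_prop)
  · intro a ha b hb hab
    exact add_lt_add_of_le_of_lt (hGmono s ha hb hab.le)
      (mul_lt_mul_of_pos_right hab (Real.exp_pos _))
  · simp [hG0]
  · refine tendsto_atTop_mono' _ ?_
      (tendsto_id.atTop_mul_const (Real.exp_pos (-s)) : Tendsto _ atTop atTop)
    filter_upwards [eventually_ge_atTop (0 : ℝ)] with a ha
    simpa using (hg0 a s).trans (hGge a ha s)
  · intro a _ b _ hab
    exact add_le_add (hGanti r hr hab) (mul_le_mul_of_nonneg_left
      (Real.exp_le_exp.2 (neg_le_neg hab)) hr)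
  · simpa using (hGlim r hr).add
      ((Real.tendsto_exp_neg_atTop_nhds_zero).const_mul r)
  · intro p hp _
    have h1 : p.2.2 ≤ g p.1 p.2.1 :=
      le_csSup (hbdd _ _) (mem_insert_of_mem _ ⟨p, hp, le_rfl, le_rfl, rfl⟩)
    have h2 : 0 ≤ p.1 * Real.exp (-p.2.1) := mul_nonneg (ha p hp) (Real.exp_pos _).le
    show p.2.2 ≤ G p.1 p.2.1 + _
    linarith [hGge p.1 (ha p hp) p.2.1]

/-- Grönwall's inequality in integral form. -/
lemma le_mul_exp_of_le_add_integral {w : ℝ → ℝ} {a b C L : ℝ} (hab : a ≤ b)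
    (hw : ContinuousOn w (Icc a b)) (hL : 0 ≤ L)
    (h : ∀ t ∈ Icc a b, w t ≤ C + L * ∫ s in a..t, w s) :
    ∀ t ∈ Icc a b, w t ≤ C * Real.exp (L * (t - a)) := by
  let v : ℝ → ℝ := IccExtend hab ((Icc a b).domRestrict w)
  have hv : Continuous v := hw.domRestrict.Icc_extend'
  have hvw : ∀ t ∈ Icc a b, v t = w t := fun t ht => IccExtend_of_mem hab _ ht
  have hvint : ∀ t ∈ Icc a b, ∫ s in a..t, v s = ∫ s in a..t, w s := by
    intro t ht
    refine intervalIntegral.integral_congr fun s hs => hvw s ?_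
    rw [uIcc_of_le ht.1] at hs
    exact ⟨hs.1, hs.2.trans ht.2⟩
  have hder : ∀ t, HasDerivAt (fun t => C + L * ∫ s in a..t, v s) (L * v t) t := fun t =>
    ((hv.integral_hasStrictDerivAt a t).hasDerivAt.const_mul L).const_add C
  have hle : ∀ t ∈ Icc a b, v t ≤ C + L * ∫ s in a..t, v s := fun t ht => by
    rw [hvw t ht, hvint t ht]; exact h t ht
  have key := le_gronwallBound_of_liminf_deriv_right_le (δ := C) (K := L) (ε := 0) (a := a) (b := b)
    (continuous_iff_continuousAt.2 fun t => (hder t).continuousAt).continuousOn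
    (fun t _ r hr => (hder t).hasDerivWithinAt.liminf_right_slope_le hr) (by simp)
    (fun t ht => by
      have := mul_le_mul_of_nonneg_left (hle t (Ico_subset_Icc_self ht)) hL
      simpa using this)
  intro t ht
  have h1 := key t ht
  rw [gronwallBound_ε0] at h1
  rw [← hvw t ht]
  exact (hle t ht).trans h1

lemma measurable_comp_of_caratheodory {X Y : Type*} [TopologicalSpace X]
    [TopologicalSpace.MetrizableSpace X] [MeasurableSpace X] [OpensMeasurableSpace X]
    [SecondCountableTopology X] [TopologicalSpace Y] [TopologicalSpace.PseudoMetrizableSpace Y]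
    [MeasurableSpace Y] [BorelSpace Y] {G : ℝ → X → Y}
    (hm : ∀ ξ, Measurable fun t => G t ξ) (hc : ∀ t, Continuous (G t)) {y : ℝ → X}
    (hy : Measurable y) : Measurable fun t => G t (y t) := by
  have := measurable_uncurry_of_continuous_of_measurable (u := fun ξ t => G t ξ) hc hm
  exact this.comp (hy.prodMk measurable_id)

section Peano

variable [FiniteDimensional ℝ E] [BorelSpace E] {G : ℝ → E → E} {M : ℝ}

lemma intervalIntegrable_comp_of_bounded (hm : ∀ ξ, Measurable fun t => G t ξ)
    (hc : ∀ t, Continuous (G t)) (hM : ∀ t ξ, ‖G t ξ‖ ≤ M) {y : ℝ → E} (hy : Continuous y)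
    (a b : ℝ) : IntervalIntegrable (fun s => G s (y s)) volume a b := by
  refine (intervalIntegrable_const (c := M)).mono_fun
    (measurable_comp_of_caratheodory hm hc hy.measurable).aestronglyMeasurable ?_
  exact Eventually.of_forall fun s => (hM s (y s)).trans (le_abs_self M)

/-- The delayed Picard operator whose fixed points are Tonelli's approximate solutions. -/
def tonelliMap (G : ℝ → E → E) (b : ℝ) (x₀ : E) (δ : ℝ) (y : ℝ → E) : ℝ → E :=
  fun t => x₀ + ∫ s in b..max b (t - δ), G s (y s)

lemma norm_tonelliMap_sub_le (hm : ∀ ξ, Measurable fun t => G t ξ)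
    (hc : ∀ t, Continuous (G t)) (hM : ∀ t ξ, ‖G t ξ‖ ≤ M) (b : ℝ) (x₀ : E) (δ : ℝ) {y : ℝ → E}
    (hy : Continuous y) (t t' : ℝ) :
    ‖tonelliMap G b x₀ δ y t - tonelliMap G b x₀ δ y t'‖ ≤ M * |t - t'| := by
  have hint := intervalIntegrable_comp_of_bounded hm hc hM hy
  have hM0 : 0 ≤ M := (norm_nonneg _).trans (hM 0 0)
  simp only [tonelliMap, add_sub_add_left_eq_sub]
  rw [intervalIntegral.integral_interval_sub_left (hint _ _) (hint _ _)]
  refine (intervalIntegral.norm_integral_le_of_norm_le_const fun s _ => hM s (y s)).trans ?_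
  refine mul_le_mul_of_nonneg_left ?_ hM0
  have := abs_max_sub_max_le_abs (t - δ) (t' - δ) b
  rw [max_comm b, max_comm b]
  simpa using this

/-- Tonelli's approximate solutions: Lipschitz solutions of the delayed integral equation. -/
lemma exists_tonelli_approx (hm : ∀ ξ, Measurable fun t => G t ξ)
    (hc : ∀ t, Continuous (G t)) (hM : ∀ t ξ, ‖G t ξ‖ ≤ M) (b : ℝ) (x₀ : E) (k : ℕ) :
    ∃ y : ℝ → E, (∀ t t', ‖y t - y t'‖ ≤ M * |t - t'|) ∧ y b = x₀ ∧
      ∀ t ≤ b + 1, y t = x₀ + ∫ s in b..max b (t - 1 / ((k : ℝ) + 1)), G s (y s) := by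
  have hM0 : 0 ≤ M := (norm_nonneg _).trans (hM 0 0)
  set δ : ℝ := 1 / ((k : ℝ) + 1) with hδ
  have hδ0 : 0 < δ := by positivity
  let Y : ℕ → ℝ → E := fun j => (tonelliMap G b x₀ δ)^[j] fun _ => x₀
  have hYs : ∀ j, Y (j + 1) = tonelliMap G b x₀ δ (Y j) := fun j =>
    Function.iterate_succ_apply' _ _ _
  have hcont : ∀ y : ℝ → E, (∀ t t', ‖y t - y t'‖ ≤ M * |t - t'|) → Continuous y := fun y hy =>
    (LipschitzWith.of_dist_le_mul (K := ⟨M, hM0⟩) fun t t' => by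
      rw [dist_eq_norm, Real.dist_eq]; exact hy t t').continuous
  have hlip : ∀ j t t', ‖Y j t - Y j t'‖ ≤ M * |t - t'| := by
    intro j
    induction j with
    | zero => intro t t'; simp only [Y, Function.iterate_zero, id, sub_self, norm_zero]; positivity
    | succ j ih => rw [hYs]; exact norm_tonelliMap_sub_le hm hc hM b x₀ δ (hcont _ ih)
  have hstab : ∀ j : ℕ, ∀ t ≤ b + j * δ, Y (j + 1) t = Y j t := by
    intro j
    induction j with
    | zero =>
      intro t ht
      have h1 : max b (t - δ) = b := max_eq_left (by norm_num at ht; linarith)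
      rw [hYs]
      simp [tonelliMap, h1, Y]
    | succ j ih =>
      intro t ht
      rw [hYs (j + 1)]
      conv_rhs => rw [hYs j]
      simp only [tonelliMap]
      congr 1
      refine intervalIntegral.integral_congr fun s hs => ?_
      rw [uIcc_of_le (le_max_left _ _)] at hs
      have h2 : s ≤ b + j * δ := by
        refine hs.2.trans (max_le ?_ ?_)
        · have : 0 ≤ (j : ℝ) * δ := by positivity
          linarith
        · push_cast at ht; linarith
      simp only [ih s h2]
  have hk : ((k + 1 : ℕ) : ℝ) * δ = 1 := by
    rw [hδ]; push_cast; field_simp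
  refine ⟨Y (k + 1), hlip _, ?_, fun t ht => ?_⟩
  · rw [hYs]
    simp [tonelliMap, max_eq_left (show b - δ ≤ b by linarith)]
  · rw [← hstab (k + 1) t (by rw [hk]; exact ht), hYs (k + 1)]
    rfl

/-- Carathéodory's existence theorem for bounded right-hand sides. -/
lemma exists_integral_solution_of_bounded (hm : ∀ ξ, Measurable fun t => G t ξ)
    (hc : ∀ t, Continuous (G t)) (hM : ∀ t ξ, ‖G t ξ‖ ≤ M) (b : ℝ) (x₀ : E) :
    ∃ y : ℝ → E, Continuous y ∧ ∀ t ∈ Icc b (b + 1), y t = x₀ + ∫ s in b..t, G s (y s) := by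
  have hM0 : 0 ≤ M := (norm_nonneg _).trans (hM 0 0)
  choose Y hlip hb hY using exists_tonelli_approx hm hc hM b x₀
  have hcont : ∀ k, Continuous (Y k) := fun k =>
    (LipschitzWith.of_dist_le_mul (K := ⟨M, hM0⟩) fun t t' => by
      rw [dist_eq_norm, Real.dist_eq]; exact hlip k t t').continuous
  have hbb : b ≤ b + 1 := by linarith
  let Z : ℕ → BoundedContinuousFunction (Icc b (b + 1)) E := fun k =>
    BoundedContinuousFunction.mkOfCompact ⟨fun t => Y k t, (hcont k).comp continuous_subtype_val⟩
  have hZ : ∀ k t, Z k t = Y k t := fun k t => rfl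
  have hcomp : IsCompact (closure (range Z)) := by
    refine BoundedContinuousFunction.arzela_ascoli (Metric.closedBall x₀ M)
      (isCompact_closedBall _ _) _ ?_ ?_
    · rintro _ t ⟨k, rfl⟩
      rw [hZ, mem_closedBall_iff_norm]
      have h1 := hlip k t b
      rw [hb k] at h1
      refine h1.trans ?_
      have h2 : |(t : ℝ) - b| ≤ 1 := abs_le.2 ⟨by linarith [t.2.1], by linarith [t.2.2]⟩
      simpa using mul_le_mul_of_nonneg_left h2 hM0
    · refine (LipschitzWith.uniformEquicontinuous _ ⟨M, hM0⟩ ?_).equicontinuous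
      rintro ⟨_, k, rfl⟩
      refine LipschitzWith.of_dist_le_mul fun t t' => ?_
      rw [dist_eq_norm, Subtype.dist_eq, Real.dist_eq]
      exact hlip k t t'
  obtain ⟨z, -, φ, hφ, hlim⟩ := hcomp.tendsto_subseq fun k => subset_closure (mem_range_self k)
  have hpt : ∀ t (ht : t ∈ Icc b (b + 1)), Tendsto (fun k => Y (φ k) t) atTop (𝓝 (z ⟨t, ht⟩)) :=
    fun t ht => by
      have h1 := BoundedContinuousFunction.lipschitz_eval_const (β := E) (⟨t, ht⟩ : Icc b (b + 1))
      exact (h1.continuous.tendsto z).comp hlim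
  let y : ℝ → E := IccExtend hbb z
  have hyz : ∀ t (ht : t ∈ Icc b (b + 1)), y t = z ⟨t, ht⟩ := fun t ht => IccExtend_of_mem hbb _ ht
  refine ⟨y, z.continuous.Icc_extend', fun t ht => ?_⟩
  have h1 : Tendsto (fun k => x₀ + ∫ s in b..t, G s (Y (φ k) s)) atTop
      (𝓝 (x₀ + ∫ s in b..t, G s (y s))) := by
    refine tendsto_const_nhds.add
      (intervalIntegral.tendsto_integral_filter_of_dominated_convergence (fun _ => M) ?_ ?_
        intervalIntegrable_const ?_)
    · exact Eventually.of_forall fun k =>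
        (measurable_comp_of_caratheodory hm hc (hcont _).measurable).aestronglyMeasurable
    · exact Eventually.of_forall fun k => Eventually.of_forall fun s _ => hM _ _
    · refine Eventually.of_forall fun s hs => ?_
      rw [uIoc_of_le ht.1] at hs
      have hs' : s ∈ Icc b (b + 1) := ⟨hs.1.le, hs.2.trans ht.2⟩
      rw [hyz s hs']
      exact ((hc s).tendsto _).comp (hpt s hs')
  have h2 : Tendsto (fun k => Y (φ k) t - (x₀ + ∫ s in b..t, G s (Y (φ k) s))) atTop (𝓝 0) := by
    have h3 : Tendsto (fun k => M * (1 / ((φ k : ℝ) + 1))) atTop (𝓝 0) := by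
      simpa using ((tendsto_one_div_add_atTop_nhds_zero_nat (𝕜 := ℝ)).comp
        hφ.tendsto_atTop).const_mul M
    refine squeeze_zero_norm (fun k => ?_) h3
    have hint := intervalIntegrable_comp_of_bounded hm hc hM (hcont (φ k))
    rw [hY (φ k) t ht.2, add_sub_add_left_eq_sub,
      intervalIntegral.integral_interval_sub_left (hint _ _) (hint _ _)]
    refine (intervalIntegral.norm_integral_le_of_norm_le_const fun s _ => hM _ _).trans ?_
    refine mul_le_mul_of_nonneg_left ?_ hM0
    have hδ : 0 < 1 / ((φ k : ℝ) + 1) := by positivity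
    rw [abs_le]
    refine ⟨by linarith [le_max_right b (t - 1 / ((φ k : ℝ) + 1))], ?_⟩
    linarith [max_le ht.1 (show t - 1 / ((φ k : ℝ) + 1) ≤ t by linarith)]
  have h4 : Tendsto (fun k => Y (φ k) t) atTop (𝓝 (x₀ + ∫ s in b..t, G s (y s))) := by
    simpa using h2.add h1
  rw [hyz t ht]
  exact tendsto_nhds_unique (hpt t ht) h4

end Peano

section Solutions

variable {f : ℝ → E → F → Γ → E} {u : ℝ → F} {σ : ℝ → Γ} {D D' : Set ℝ} {x y : ℝ → E} {γ : ℝ → ℝ}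

lemma integral_congr_uIoc {a b : ℝ} {g h : ℝ → E} (hgh : EqOn g h (uIoc a b)) :
    ∫ s in a..b, g s = ∫ s in a..b, h s :=
  intervalIntegral.integral_congr_ae (Eventually.of_forall hgh)

lemma continuousOn_of_forall_Icc {X : Type*} [TopologicalSpace X] {x : ℝ → X}
    (h : ∀ a ∈ D, ∀ b ∈ D, ContinuousOn x (Icc a b)) : ContinuousOn x D := by
  intro p hp
  obtain ⟨a, ha, hap, hal⟩ : ∃ a ∈ D, a ≤ p ∧ Ici a ∈ 𝓝[D] p := by
    by_cases hex : ∃ a ∈ D, a < p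
    · obtain ⟨a, ha, hlt⟩ := hex
      exact ⟨a, ha, hlt.le, mem_nhdsWithin_of_mem_nhds (Ici_mem_nhds hlt)⟩
    · push Not at hex
      exact ⟨p, hp, le_rfl, mem_of_superset self_mem_nhdsWithin hex⟩
  obtain ⟨b, hb, hpb, hbl⟩ : ∃ b ∈ D, p ≤ b ∧ Iic b ∈ 𝓝[D] p := by
    by_cases hex : ∃ b ∈ D, p < b
    · obtain ⟨b, hb, hlt⟩ := hex
      exact ⟨b, hb, hlt.le, mem_nhdsWithin_of_mem_nhds (Iic_mem_nhds hlt)⟩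
    · push Not at hex
      exact ⟨p, hp, le_rfl, mem_of_superset self_mem_nhdsWithin hex⟩
  exact (h a ha b hb p ⟨hap, hpb⟩).mono_of_mem_nhdsWithin (inter_mem hal hbl)

/-- It suffices to check the integral equation from one base point. -/
lemma isSolution_of_base (hD : D.OrdConnected) (hsub : D ⊆ Ici 0) {c : ℝ} (hc : c ∈ D)
    (hint : ∀ b ∈ D, IntervalIntegrable (fun s => f s (x s) (u s) (σ s)) volume c b)
    (heq : ∀ b ∈ D, x b = x c + ∫ s in c..b, f s (x s) (u s) (σ s)) :
    IsSolution f u σ D x := by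
  have hint' : ∀ a ∈ D, ∀ b ∈ D,
      IntervalIntegrable (fun s => f s (x s) (u s) (σ s)) volume a b :=
    fun a ha b hb => (hint a ha).symm.trans (hint b hb)
  have heq' : ∀ a ∈ D, ∀ b ∈ D, x b = x a + ∫ s in a..b, f s (x s) (u s) (σ s) := by
    intro a ha b hb
    rw [heq b hb, heq a ha, add_assoc, intervalIntegral.integral_add_adjacent_intervals
      (hint a ha) (hint' a ha b hb)]
  refine ⟨hD, hsub, ⟨c, hc⟩, continuousOn_of_forall_Icc fun a ha b hb => ?_, hint', heq'⟩
  rcases le_total a b with hab | hab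
  · have h1 := intervalIntegral.continuousOn_primitive_interval' (hint' a ha b hb) left_mem_uIcc
    rw [uIcc_of_le hab] at h1
    exact (continuousOn_const.add h1).congr fun s hs => heq' a ha s (hD.out ha hb hs)
  · exact (subsingleton_Icc_of_ge hab).continuousOn x

lemma IsSolution.restrict (h : IsSolution f u σ D x) (hsub : D' ⊆ D) (hD' : D'.OrdConnected)
    (hne : D'.Nonempty) : IsSolution f u σ D' x :=
  ⟨hD', hsub.trans h.subset_Ici, hne, h.continuousOn.mono hsub,
    fun a ha b hb => h.intervalIntegrable a (hsub ha) b (hsub hb),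
    fun a ha b hb => h.integral_eq a (hsub ha) b (hsub hb)⟩

lemma isSolution_singleton {c : ℝ} (hc : 0 ≤ c) (x : ℝ → E) : IsSolution f u σ {c} x :=
  isSolution_of_base ordConnected_singleton (by simpa using hc) (mem_singleton c)
    (by rintro b rfl; simp) (by rintro b rfl; simp)

/-- Concatenation of two solutions which agree at a common end point. -/
lemma IsSolution.concat {D₁ D₂ : Set ℝ} (h₁ : IsSolution f u σ D₁ x) (h₂ : IsSolution f u σ D₂ y)
    {c : ℝ} (hc₁ : c ∈ D₁) (hc₂ : c ∈ D₂) (hD₁ : D₁ ⊆ Iic c) (hD₂ : D₂ ⊆ Ici c) (hxy : x c = y c) :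
    IsSolution f u σ (D₁ ∪ D₂) fun t => if t ≤ c then x t else y t := by
  have hint₁ : ∀ b ∈ D₁, EqOn (fun s => f s (x s) (u s) (σ s))
      (fun s => f s (if s ≤ c then x s else y s) (u s) (σ s)) (uIoc c b) := by
    intro b hb s hs
    rw [uIoc_of_ge (hD₁ hb)] at hs
    simp [hs.2]
  have hint₂ : ∀ b ∈ D₂, EqOn (fun s => f s (y s) (u s) (σ s))
      (fun s => f s (if s ≤ c then x s else y s) (u s) (σ s)) (uIoc c b) := by
    intro b hb s hs
    rw [uIoc_of_le (hD₂ hb)] at hs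
    simp [hs.1.not_ge]
  refine isSolution_of_base (c := c) ?_ (union_subset h₁.subset_Ici h₂.subset_Ici) (Or.inl hc₁) ?_ ?_
  · rw [← isPreconnected_iff_ordConnected]
    exact IsPreconnected.union c hc₁ hc₂ (isPreconnected_iff_ordConnected.2 h₁.ordConnected)
      (isPreconnected_iff_ordConnected.2 h₂.ordConnected)
  · rintro b (hb | hb)
    · exact (h₁.intervalIntegrable c hc₁ b hb).congr (hint₁ b hb)
    · exact (h₂.intervalIntegrable c hc₂ b hb).congr (hint₂ b hb)
  · rintro b (hb | hb)
    · rw [← integral_congr_uIoc (hint₁ b hb)]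
      simpa [show b ≤ c from hD₁ hb] using h₁.integral_eq c hc₁ b hb
    · rw [← integral_congr_uIoc (hint₂ b hb)]
      have h3 := h₂.integral_eq c hc₂ b hb
      rcases (show c ≤ b from hD₂ hb).eq_or_lt with rfl | hlt
      · simp
      · simpa [hlt.not_ge, hxy] using h3

/-- Every solution extends to a maximally defined one. -/
lemma IsSolution.exists_maximal (h : IsSolution f u σ D x) :
    ∃ D' x', IsMaximalSolution f u σ D' x' ∧ D ⊆ D' ∧ EqOn x x' D := by
  classical
  let α := {p : Set ℝ × (ℝ → E) // IsSolution f u σ p.1 p.2 ∧ D ⊆ p.1 ∧ EqOn x p.2 D}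
  let r : α → α → Prop := fun p q => p.1.1 ⊆ q.1.1 ∧ EqOn p.1.2 q.1.2 p.1.1
  have hne : Nonempty α := ⟨⟨(D, x), h, Subset.rfl, fun _ _ => rfl⟩⟩
  have htrans : ∀ {a b c : α}, r a b → r b c → r a c := fun {a b c} hab hbc =>
    ⟨hab.1.trans hbc.1, fun t ht => (hab.2 ht).trans (hbc.2 (hab.1 ht))⟩
  obtain ⟨m, hm⟩ := exists_maximal_of_nonempty_chains_bounded (r := r) (fun c hc hcne => by
    let U : Set ℝ := {t | ∃ p ∈ c, t ∈ p.1.1}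
    let X : ℝ → E := fun t => if ht : ∃ p ∈ c, t ∈ p.1.1 then ht.choose.1.2 t else 0
    have htot : ∀ p ∈ c, ∀ q ∈ c, r p q ∨ r q p := fun p hp q hq => by
      by_cases hpq : p = q
      · exact Or.inl (hpq ▸ ⟨Subset.rfl, fun _ _ => rfl⟩)
      · exact hc hp hq hpq
    have hX : ∀ p ∈ c, EqOn p.1.2 X p.1.1 := by
      intro p hp t ht
      have hex : ∃ p ∈ c, t ∈ p.1.1 := ⟨p, hp, ht⟩
      have hXt : X t = hex.choose.1.2 t := dif_pos hex
      rw [hXt]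
      rcases htot p hp _ hex.choose_spec.1 with hr | hr
      · exact hr.2 ht
      · exact (hr.2 hex.choose_spec.2).symm
    have hcommon : ∀ a ∈ U, ∀ b ∈ U, ∃ p ∈ c, a ∈ p.1.1 ∧ b ∈ p.1.1 := by
      rintro a ⟨p, hp, hap⟩ b ⟨q, hq, hbq⟩
      rcases htot p hp q hq with hr | hr
      · exact ⟨q, hq, hr.1 hap, hbq⟩
      · exact ⟨p, hp, hap, hr.1 hbq⟩
    have hcongr : ∀ p ∈ c, ∀ a ∈ p.1.1, ∀ b ∈ p.1.1, EqOn (fun s => f s (p.1.2 s) (u s) (σ s))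
        (fun s => f s (X s) (u s) (σ s)) (uIoc a b) := by
      intro p hp a ha b hb s hs
      simp only [hX p hp (p.2.1.ordConnected.uIcc_subset ha hb (uIoc_subset_uIcc hs))]
    have hsol : IsSolution f u σ U X := by
      obtain ⟨p₀, hp₀⟩ := hcne
      refine ⟨⟨fun a ha b hb s hs => ?_⟩, ?_, ?_, ?_, ?_, ?_⟩
      · obtain ⟨p, hp, hap, hbp⟩ := hcommon a ha b hb
        exact ⟨p, hp, p.2.1.ordConnected.out hap hbp hs⟩
      · rintro t ⟨p, hp, ht⟩
        exact p.2.1.subset_Ici ht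
      · obtain ⟨t, ht⟩ := p₀.2.1.nonempty
        exact ⟨t, p₀, hp₀, ht⟩
      · refine continuousOn_of_forall_Icc fun a ha b hb => ?_
        obtain ⟨p, hp, hap, hbp⟩ := hcommon a ha b hb
        have hsub := p.2.1.ordConnected.out hap hbp
        exact (p.2.1.continuousOn.mono hsub).congr fun t ht => (hX p hp (hsub ht)).symm
      · intro a ha b hb
        obtain ⟨p, hp, hap, hbp⟩ := hcommon a ha b hb
        exact (p.2.1.intervalIntegrable a hap b hbp).congr (hcongr p hp a hap b hbp)
      · intro a ha b hb
        obtain ⟨p, hp, hap, hbp⟩ := hcommon a ha b hb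
        rw [← hX p hp hap, ← hX p hp hbp,
          ← integral_congr_uIoc (hcongr p hp a hap b hbp)]
        exact p.2.1.integral_eq a hap b hbp
    obtain ⟨p₀, hp₀⟩ := hcne
    refine ⟨⟨(U, X), hsol, fun t ht => ⟨p₀, hp₀, p₀.2.2.1 ht⟩, fun t ht => ?_⟩, fun p hp =>
      ⟨fun t ht => ⟨p, hp, ht⟩, hX p hp⟩⟩
    exact (p₀.2.2.2 ht).trans (hX p₀ hp₀ (p₀.2.2.1 ht))) htrans
  refine ⟨m.1.1, m.1.2, ⟨m.2.1, fun D' x' hs hsub heq => ?_⟩, m.2.2.1, m.2.2.2⟩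
  exact (hm ⟨(D', x'), hs, m.2.2.1.trans hsub, fun t ht =>
    (m.2.2.2 ht).trans (heq (m.2.2.1 ht))⟩ ⟨hsub, heq⟩).1

end Solutions

lemma IsSwitchingSignal.exists_eq_const {σ : ℝ → Γ} (hσ : IsSwitchingSignal σ) {b : ℝ}
    (hb : 0 ≤ b) : ∃ h, 0 < h ∧ ∃ i, ∀ s ∈ Ico b (b + h), σ s = i := by
  classical
  obtain ⟨n, t, h0, -, hn, hc⟩ := hσ (b + 1) (by linarith)
  have hex : ∃ j, b < t j := ⟨n, by linarith⟩
  have hj := Nat.find_spec hex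
  obtain ⟨k, hk⟩ : ∃ k, Nat.find hex = k + 1 := Nat.exists_eq_succ_of_ne_zero fun h => by
    rw [h, h0] at hj; linarith
  have hkb : t k ≤ b := not_lt.1 (Nat.find_min hex (by omega))
  have hkn : k < n := by
    have := Nat.find_min' hex (show b < t n by linarith)
    omega
  rw [hk] at hj
  exact ⟨t (k + 1) - b, by linarith, σ (t k), fun s hs =>
    hc k hkn s ⟨hkb.trans hs.1, by linarith [hs.2]⟩⟩

/-- The radial retraction onto the closed unit ball around `c`. -/
def ballRetraction (c ξ : E) : E := c + (max 1 ‖ξ - c‖)⁻¹ • (ξ - c)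

lemma continuous_ballRetraction (c : E) : Continuous (ballRetraction c) := by
  unfold ballRetraction
  have : Continuous fun ξ : E => (max 1 ‖ξ - c‖)⁻¹ :=
    Continuous.inv₀ (by fun_prop) fun ξ => (lt_of_lt_of_le one_pos (le_max_left _ _)).ne'
  fun_prop

lemma norm_ballRetraction_sub_le (c ξ : E) : ‖ballRetraction c ξ - c‖ ≤ 1 := by
  have h : 0 < max 1 ‖ξ - c‖ := lt_of_lt_of_le one_pos (le_max_left _ _)
  rw [ballRetraction, add_sub_cancel_left, norm_smul, norm_inv, Real.norm_eq_abs, abs_of_pos h,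
    inv_mul_le_iff₀ h, mul_one]
  exact le_max_right _ _

lemma ballRetraction_of_norm_le {c ξ : E} (h : ‖ξ - c‖ ≤ 1) : ballRetraction c ξ = ξ := by
  simp [ballRetraction, max_eq_left h]

section Extension

variable [FiniteDimensional ℝ E] [BorelSpace E] [FiniteDimensional ℝ F] [BorelSpace F]
  {f : ℝ → E → F → Γ → E} {u : ℝ → F} {σ : ℝ → Γ} {D : Set ℝ} {x : ℝ → E} {γ : ℝ → ℝ}

lemma IsInput.exists_bound (hu : IsInput u) (b : ℝ) :
    ∃ C, 0 ≤ C ∧ ∀ᵐ s ∂volume, s ∈ Icc (0 : ℝ) b → ‖u s‖ ≤ C := by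
  obtain ⟨C, hC⟩ := hu.2 b
  exact ⟨max C 0, le_max_right _ _, hC.mono fun s hs h => (hs h).trans (le_max_left _ _)⟩

lemma ClassK.measurable_comp_norm {φ : ℝ → ℝ} (hφ : ClassK φ) (hu : IsInput u) :
    Measurable fun s => φ ‖u s‖ := by
  have h1 : Continuous fun s : ℝ => φ (max s 0) :=
    hφ.1.comp_continuous (by fun_prop) fun s => le_max_right s 0
  have h2 := h1.measurable.comp hu.1.norm
  simpa [Function.comp_def] using h2

lemma ClassK.intervalIntegrable_comp_norm {φ : ℝ → ℝ} (hφ : ClassK φ) (hu : IsInput u) {a b : ℝ}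
    (ha : 0 ≤ a) (hb : 0 ≤ b) : IntervalIntegrable (fun s => φ ‖u s‖) volume a b := by
  obtain ⟨C, hC0, hC⟩ := hu.exists_bound (max a b)
  refine (intervalIntegrable_const (c := φ C)).mono_fun
    (hφ.measurable_comp_norm hu).aestronglyMeasurable ?_
  filter_upwards [ae_restrict_of_ae hC, ae_restrict_mem measurableSet_uIoc] with s h1 h2
  have h3 : s ∈ Icc 0 (max a b) := ⟨(le_min ha hb).trans h2.1.le, h2.2⟩
  rw [Real.norm_of_nonneg (hφ.nonneg (norm_nonneg _)), Real.norm_of_nonneg (hφ.nonneg hC0)]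
  exact hφ.mono (norm_nonneg _) (h1 h3)

/-- Local existence of Carathéodory solutions to the right. -/
lemma exists_local_solution (hreg : Regular f) (hγ : ClassK γ) (hC1 : CondC1 f γ)
    (hu : IsInput u) (hσ : IsSwitchingSignal σ) {b : ℝ} (hb : 0 ≤ b) (x₀ : E) :
    ∃ h, 0 < h ∧ ∃ y, IsSolution f u σ (Icc b (b + h)) y ∧ y b = x₀ := by
  classical
  obtain ⟨h₀, hh₀, i, hi⟩ := hσ.exists_eq_const hb
  obtain ⟨C, hC0, hC⟩ := hu.exists_bound (b + 1)
  obtain ⟨N, hN0, hNm, hN⟩ := hC1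
  let M : ℝ := N (‖x₀‖ + 1) * (1 + γ C)
  have hr : 0 ≤ ‖x₀‖ + 1 := by positivity
  have hMpos : 0 < M := mul_pos (hN0 _ hr) (by linarith [hγ.nonneg hC0])
  let A : Set ℝ := {t | t ∈ Ico b (b + h₀) ∧ ‖u t‖ ≤ C}
  have hA : MeasurableSet A := measurableSet_Ico.inter (measurableSet_le hu.1.norm measurable_const)
  let G : ℝ → E → E := fun t ξ => if t ∈ A then f t (ballRetraction x₀ ξ) (u t) i else 0
  have hGm : ∀ ξ, Measurable fun t => G t ξ := fun ξ =>
    Measurable.ite hA (measurable_comp_of_caratheodory (G := fun t μ => f t (ballRetraction x₀ ξ) μ i)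
      (fun μ => hreg.2.1 _ μ i) (fun t => (hreg.2.2 t i).comp (continuous_const.prodMk continuous_id)) hu.1) measurable_const
  have hGc : ∀ t, Continuous (G t) := by
    intro t
    by_cases ht : t ∈ A
    · simp only [G, ht, if_true]
      exact (hreg.2.2 t i).comp ((continuous_ballRetraction x₀).prodMk continuous_const)
    · simp only [G, ht, if_false]
      exact continuous_const
  have hGM : ∀ t ξ, ‖G t ξ‖ ≤ M := by
    intro t ξ
    by_cases ht : t ∈ A
    · simp only [G, ht, if_true]
      refine (hN t (hb.trans ht.1.1) _ _ _).trans (mul_le_mul ?_ ?_ ?_ (hN0 _ hr).le)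
      · refine hNm (mem_Ici.2 (norm_nonneg _)) (mem_Ici.2 hr) ?_
        have h1 := norm_le_norm_add_norm_sub x₀ (ballRetraction x₀ ξ)
        rw [norm_sub_rev] at h1
        linarith [norm_ballRetraction_sub_le x₀ ξ]
      · linarith [hγ.mono (norm_nonneg _) ht.2]
      · linarith [hγ.nonneg (norm_nonneg (u t))]
    · simp only [G, ht, if_false, norm_zero]
      exact hMpos.le
  obtain ⟨y, hyc, hy⟩ := exists_integral_solution_of_bounded hGm hGc hGM b x₀
  have hyint := intervalIntegrable_comp_of_bounded hGm hGc hGM hyc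
  let h : ℝ := min (h₀ / 2) (min 1 M⁻¹)
  have hh : 0 < h := by positivity
  have hh1 : h ≤ h₀ / 2 := min_le_left _ _
  have hh2 : h ≤ 1 := (min_le_right _ _).trans (min_le_left _ _)
  have hh3 : M * h ≤ 1 := by
    have : h ≤ M⁻¹ := (min_le_right _ _).trans (min_le_right _ _)
    calc M * h ≤ M * M⁻¹ := mul_le_mul_of_nonneg_left this hMpos.le
      _ = 1 := mul_inv_cancel₀ hMpos.ne'
  have hyb : y b = x₀ := by simpa using hy b ⟨le_rfl, by linarith⟩
  have hball : ∀ s ∈ Icc b (b + h), ‖y s - x₀‖ ≤ 1 := by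
    intro s hs
    rw [hy s ⟨hs.1, by linarith [hs.2]⟩, add_sub_cancel_left]
    refine (intervalIntegral.norm_integral_le_of_norm_le_const fun s _ => hGM s (y s)).trans ?_
    rw [abs_of_nonneg (by linarith [hs.1])]
    exact (mul_le_mul_of_nonneg_left (by linarith [hs.2]) hMpos.le).trans hh3
  have hae : ∀ t ∈ Icc b (b + h), ∀ᵐ s ∂volume, s ∈ uIoc b t →
      G s (y s) = f s (y s) (u s) (σ s) := by
    intro t ht
    filter_upwards [hC] with s hs hst
    rw [uIoc_of_le ht.1] at hst
    have h1 : s ∈ Icc b (b + h) := ⟨hst.1.le, hst.2.trans ht.2⟩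
    have h2 : s ∈ Ico b (b + h₀) := ⟨h1.1, by linarith [h1.2]⟩
    have h3 : s ∈ A := ⟨h2, hs ⟨hb.trans h1.1, by linarith [h1.2]⟩⟩
    simp only [G, h3, if_true, ballRetraction_of_norm_le (hball s h1), hi s h2]
  refine ⟨h, hh, y, isSolution_of_base ordConnected_Icc (fun s hs => hb.trans hs.1)
    (left_mem_Icc.2 (by linarith)) (fun t ht => ?_) (fun t ht => ?_), hyb⟩
  · exact (hyint b t).congr_ae ((ae_restrict_iff' measurableSet_uIoc).2 (hae t ht))
  · rw [← intervalIntegral.integral_congr_ae (hae t ht), hyb]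
    exact hy t ⟨ht.1, by linarith [ht.2]⟩

/-- A maximally defined solution which is bounded on bounded time intervals is defined for
all future times. -/
lemma IsMaximalSolution.Ici_subset (hreg : Regular f) (hγ : ClassK γ) (hC1 : CondC1 f γ)
    (hu : IsInput u) (hσ : IsSwitchingSignal σ) (hx : IsMaximalSolution f u σ D x) {t₀ : ℝ}
    (ht₀ : t₀ ∈ D) (hbdd : ∀ T, ∃ R, ∀ t ∈ D, t₀ ≤ t → t ≤ T → ‖x t‖ ≤ R) : Ici t₀ ⊆ D := by
  by_contra hcon
  obtain ⟨T, hT, hTD⟩ := not_subset.1 hcon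
  obtain ⟨hsol, hmax⟩ := hx
  have hoc := hsol.ordConnected
  have ht₀0 : 0 ≤ t₀ := hsol.subset_Ici ht₀
  have hDT : ∀ s ∈ D, s ≤ T := fun s hs => le_of_not_gt fun h => hTD (hoc.out ht₀ hs ⟨hT, h.le⟩)
  have hDb : BddAbove D := ⟨T, hDT⟩
  set b := sSup D with hbdef
  have htb : t₀ ≤ b := le_csSup hDb ht₀
  have hbT : b ≤ T := csSup_le ⟨t₀, ht₀⟩ hDT
  have hmem : ∀ s, t₀ ≤ s → s < b → s ∈ D := by
    intro s hs hsb
    obtain ⟨d, hd, hsd⟩ := exists_lt_of_lt_csSup ⟨t₀, ht₀⟩ hsb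
    exact hoc.out ht₀ hd ⟨hs, hsd.le⟩
  obtain ⟨R, hR⟩ := hbdd T
  have hR0 : 0 ≤ R := (norm_nonneg _).trans (hR t₀ ht₀ le_rfl hT)
  obtain ⟨C, hC0, hC⟩ := hu.exists_bound T
  let g : ℝ → E := fun s => f s (x s) (u s) (σ s)
  have hgint : IntegrableOn g (Ioo t₀ b) := by
    rcases htb.eq_or_lt with heq | hlt
    · simp [← heq]
    obtain ⟨N, hN0, hNm, hN⟩ := hC1
    have hmeas : AEStronglyMeasurable g (volume.restrict (Ioo t₀ b)) := by
      have hc : Tendsto (fun n : ℕ => max t₀ (b - 1 / ((n : ℝ) + 1))) atTop (𝓝 b) := by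
        have h1 : Tendsto (fun n : ℕ => b - 1 / ((n : ℝ) + 1)) atTop (𝓝 (b - 0)) :=
          tendsto_const_nhds.sub tendsto_one_div_add_atTop_nhds_zero_nat
        simpa [max_eq_right htb] using (tendsto_const_nhds (x := t₀)).max h1
      refine (aecover_Ioo_of_Ioc tendsto_const_nhds hc).aestronglyMeasurable fun n => ?_
      have h2 : max t₀ (b - 1 / ((n : ℝ) + 1)) ∈ D := hmem _ (le_max_left _ _)
        (max_lt hlt (by linarith [show 0 < 1 / ((n : ℝ) + 1) by positivity]))
      exact (hsol.intervalIntegrable t₀ ht₀ _ h2).1.aestronglyMeasurable.mono_measure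
        (Measure.restrict_mono_measure Measure.restrict_le_self _)
    refine IntegrableOn.of_bound (by simp) hmeas (N R * (1 + γ C)) ?_
    filter_upwards [ae_restrict_of_ae hC, ae_restrict_mem measurableSet_Ioo] with s h1 h2
    have hs0 : 0 ≤ s := ht₀0.trans h2.1.le
    have hsT : s ≤ T := h2.2.le.trans hbT
    have hxR := hR s (hmem s h2.1.le h2.2) h2.1.le hsT
    refine (hN s hs0 _ _ _).trans (mul_le_mul (hNm (mem_Ici.2 (norm_nonneg _)) (mem_Ici.2 hR0) hxR)
      ?_ ?_ (hN0 _ hR0).le)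
    · linarith [hγ.mono (norm_nonneg _) (h1 ⟨hs0, hsT⟩)]
    · linarith [hγ.nonneg (norm_nonneg (u s))]
  have hgii : ∀ t ∈ Icc t₀ b, IntervalIntegrable g volume t₀ t := by
    intro t ht
    rw [intervalIntegrable_iff_integrableOn_Ioo_of_le ht.1]
    exact hgint.mono_set (Ioo_subset_Ioo_right ht.2)
  let y : ℝ → E := fun t => x t₀ + ∫ s in t₀..t, g s
  have hyx : ∀ t ∈ D, t₀ ≤ t → y t = x t := fun t ht _ => (hsol.integral_eq t₀ ht₀ t ht).symm
  have hyt₀ : y t₀ = x t₀ := hyx t₀ ht₀ le_rfl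
  have hgy : ∀ t ∈ Icc t₀ b, EqOn g (fun s => f s (y s) (u s) (σ s)) (uIoo t₀ t) := by
    intro t ht s hs
    rw [uIoo_of_le ht.1] at hs
    simp only [g, hyx s (hmem s hs.1.le (hs.2.trans_le ht.2)) hs.1.le]
  have hysol : IsSolution f u σ (Icc t₀ b) y := by
    refine isSolution_of_base ordConnected_Icc (fun s hs => ht₀0.trans hs.1) (left_mem_Icc.2 htb)
      (fun t ht => ?_) (fun t ht => ?_)
    · have h1 := hgii t ht
      rw [intervalIntegrable_iff_integrableOn_Ioo_of_le ht.1] at h1 ⊢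
      exact h1.congr_fun (by simpa [uIoo_of_le ht.1] using hgy t ht) measurableSet_Ioo
    · rw [← intervalIntegral.integral_congr_uIoo (hgy t ht), hyt₀]
  obtain ⟨h, hh, z, hz, hzb⟩ := exists_local_solution hreg hγ hC1 hu hσ (ht₀0.trans htb) (y b)
  have hyz := hysol.concat hz (right_mem_Icc.2 htb) (left_mem_Icc.2 (by linarith))
    (fun s hs => hs.2) (fun s hs => hs.1) hzb.symm
  have hleft : IsSolution f u σ (D ∩ Iic t₀) x :=
    hsol.restrict inter_subset_left (hoc.inter ordConnected_Iic) ⟨t₀, ht₀, mem_Iic.2 le_rfl⟩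
  have hall := hleft.concat hyz ⟨ht₀, mem_Iic.2 le_rfl⟩ (Or.inl (left_mem_Icc.2 htb))
    inter_subset_right (union_subset (fun s hs => hs.1) (fun s hs => htb.trans hs.1))
    (by simp [htb, hyt₀])
  have hsub := hmax _ _ hall (fun s hs => ?_) (fun s hs => ?_)
  · have h1 : b + h ∈ D := hsub (Or.inr (Or.inr (right_mem_Icc.2 (by linarith))))
    linarith [le_csSup hDb h1]
  · rcases le_total s t₀ with h1 | h1
    · exact Or.inl ⟨hs, h1⟩
    · exact Or.inr (Or.inl ⟨h1, le_csSup hDb hs⟩)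
  · by_cases h1 : s ≤ t₀
    · simp [h1]
    · have h2 : s ≤ b := le_csSup hDb hs
      simp [h1, h2, hyx s hs (not_le.1 h1).le]

end Extension

section Stability

variable [FiniteDimensional ℝ E] [BorelSpace E] [FiniteDimensional ℝ F] [BorelSpace F]
  {f : ℝ → E → F → Γ → E} {u : ℝ → F} {σ : ℝ → Γ} {S : Set (ℝ → Γ)} {D : Set ℝ} {x : ℝ → E}
  {γ α χ : ℝ → ℝ}

/-- The effect of the input is bounded by an arbitrarily small constant plus a multiple
of `γ(|μ|)`. -/
lemma exists_norm_sub_le_add_mul (hγ : ClassK γ) (hC1 : CondC1 f γ) (hC2 : CondC2 f) {R ε : ℝ}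
    (hR : 0 < R) (hε : 0 < ε) :
    ∃ κ, 0 ≤ κ ∧ ∀ t, 0 ≤ t → ∀ (i : Γ) (ξ : E) (μ : F), ‖ξ‖ ≤ R →
      ‖f t ξ μ i - f t ξ 0 i‖ ≤ ε + κ * γ ‖μ‖ := by
  obtain ⟨δ, hδ, h2⟩ := hC2 R hR ε hε
  obtain ⟨N, hN0, hNm, hN⟩ := hC1
  have hNR := hN0 R hR.le
  have hγδ := hγ.pos hδ
  refine ⟨N R * (2 / γ δ + 1), by positivity, fun t ht i ξ μ hξ => ?_⟩
  have hγμ := hγ.nonneg (norm_nonneg μ)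
  rcases le_or_gt ‖μ‖ δ with hμ | hμ
  · exact (h2 t ht i ξ μ hξ hμ).le.trans (le_add_of_nonneg_right (by positivity))
  · have hNξ : N ‖ξ‖ ≤ N R := hNm (mem_Ici.2 (norm_nonneg _)) (mem_Ici.2 hR.le) hξ
    have h3 : ‖f t ξ μ i‖ ≤ N R * (1 + γ ‖μ‖) :=
      (hN t ht ξ μ i).trans (mul_le_mul_of_nonneg_right hNξ (by linarith))
    have h4 : ‖f t ξ 0 i‖ ≤ N R := by
      have := hN t ht ξ 0 i
      rw [norm_zero, hγ.2.2, add_zero, mul_one] at this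
      exact this.trans hNξ
    have h5 : 2 ≤ 2 / γ δ * γ ‖μ‖ := by
      rw [div_mul_eq_mul_div, le_div_iff₀ hγδ]
      linarith [hγ.mono hδ.le hμ.le]
    have h6 := mul_le_mul_of_nonneg_left h5 hNR.le
    have h7 := norm_sub_le (f t ξ μ i) (f t ξ 0 i)
    nlinarith

/-- Comparison of a bounded solution with the zero-input solution through the same point. -/
lemma exists_norm_le_add_mul_integral (hγ : ClassK γ) (hC1 : CondC1 f γ) (hC2 : CondC2 f)
    (hC3 : CondC3 f) (hFC : ForwardComplete f S) {β : ℝ → ℝ → ℝ} (hβ : ClassKL β)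
    (hGU : ∀ t₀, 0 ≤ t₀ → ∀ σ ∈ S, ∀ D x,
      IsMaximalSolution f (fun _ => (0 : F)) σ D x → t₀ ∈ D → ∀ t ∈ D, t₀ ≤ t →
        ‖x t‖ ≤ β ‖x t₀‖ (t - t₀)) {R T η : ℝ} (hR : 0 < R) (hT : 0 < T) (hη : 0 < η) :
    ∃ κ, 0 ≤ κ ∧ ∀ u : ℝ → F, IsInput u → ∀ σ ∈ S, ∀ D x, IsSolution f u σ D x → ∀ t₁ ∈ D,
      t₁ + T ∈ D → (∀ t ∈ Icc t₁ (t₁ + T), ‖x t‖ ≤ R) →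
        ‖x (t₁ + T)‖ ≤ β R T + η + κ * ∫ s in t₁..t₁ + T, γ ‖u s‖ := by
  obtain ⟨L, hL, hlip⟩ := hC3 (Metric.closedBall 0 (max R (β R 0))) (isCompact_closedBall _ _)
  have hexp := Real.exp_pos (L * T)
  obtain ⟨κ, hκ, hpert⟩ := exists_norm_sub_le_add_mul hγ hC1 hC2 hR
    (show 0 < η / (T * Real.exp (L * T)) by positivity)
  set ε := η / (T * Real.exp (L * T)) with hε
  have hε0 : 0 < ε := by positivity
  refine ⟨κ * Real.exp (L * T), by positivity, fun u hu σ hσ D x hx t₁ ht₁ ht₁T hxR => ?_⟩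
  have ht₁0 : 0 ≤ t₁ := hx.subset_Ici ht₁
  have htT : t₁ ≤ t₁ + T := by linarith
  have hsubD : Icc t₁ (t₁ + T) ⊆ D := hx.ordConnected.out ht₁ ht₁T
  have hzero : IsInput fun _ : ℝ => (0 : F) :=
    ⟨measurable_const, fun b => ⟨0, Eventually.of_forall fun s _ => by simp⟩⟩
  obtain ⟨D', z, hz, hDD', hzx⟩ :=
    (isSolution_singleton (f := f) (u := fun _ => (0 : F)) (σ := σ) ht₁0 x).exists_maximal
  have ht₁' : t₁ ∈ D' := hDD' (mem_singleton _)
  have hz₁ : z t₁ = x t₁ := (hzx (mem_singleton _)).symm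
  have hfwd := hFC t₁ ht₁0 _ hzero σ hσ D' z hz ht₁'
  have hx₁R : ‖x t₁‖ ≤ R := hxR t₁ (left_mem_Icc.2 htT)
  have hzβ : ∀ t, t₁ ≤ t → ‖z t‖ ≤ β R (t - t₁) := by
    intro t ht
    refine (hGU t₁ ht₁0 σ hσ D' z hz ht₁' t (hfwd ht) ht).trans ?_
    rw [hz₁]
    exact (hβ.1 (t - t₁) (by linarith)).1.mono (norm_nonneg _) hx₁R
  have hzR : ∀ t, t₁ ≤ t → ‖z t‖ ≤ β R 0 := fun t ht =>
    (hzβ t ht).trans ((hβ.2 R hR.le).1 (mem_Ici.2 le_rfl) (mem_Ici.2 (by linarith)) (by linarith))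
  have hwc : ContinuousOn (fun t => ‖x t - z t‖) (Icc t₁ (t₁ + T)) :=
    ((hx.continuousOn.mono hsubD).sub
      (hz.1.continuousOn.mono fun t ht => hfwd (mem_Ici.2 ht.1))).norm
  have hpt : ∀ s ∈ Icc t₁ (t₁ + T), ‖f s (x s) (u s) (σ s) - f s (z s) 0 (σ s)‖ ≤
      (ε + κ * γ ‖u s‖) + L * ‖x s - z s‖ := by
    intro s hs
    have hs0 : 0 ≤ s := ht₁0.trans hs.1
    refine (norm_sub_le_norm_sub_add_norm_sub _ (f s (x s) 0 (σ s)) _).trans (add_le_add ?_ ?_)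
    · exact hpert s hs0 _ _ _ (hxR s hs)
    · refine hlip s hs0 _ _ ?_ _ ?_
      · simpa using Or.inl (hxR s hs)
      · simpa using Or.inr (hzR s hs.1)
  have hbound : ∀ t ∈ Icc t₁ (t₁ + T), ‖x t - z t‖ ≤
      (ε * T + κ * ∫ s in t₁..t₁ + T, γ ‖u s‖) + L * ∫ s in t₁..t, ‖x s - z s‖ := by
    intro t ht
    have ht0 : 0 ≤ t := ht₁0.trans ht.1
    have hxi := hx.intervalIntegrable t₁ ht₁ t (hsubD ht)
    have hzi := hz.1.intervalIntegrable t₁ ht₁' t (hfwd (mem_Ici.2 ht.1))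
    have hγi := hγ.intervalIntegrable_comp_norm hu ht₁0 ht0
    have hwi : IntervalIntegrable (fun s => ‖x s - z s‖) volume t₁ t := by
      refine ContinuousOn.intervalIntegrable ?_
      rw [uIcc_of_le ht.1]
      exact hwc.mono (Icc_subset_Icc_right ht.2)
    have hεi : IntervalIntegrable (fun s => ε + κ * γ ‖u s‖) volume t₁ t :=
      intervalIntegrable_const.add (hγi.const_mul κ)
    have h1 : x t - z t = ∫ s in t₁..t, (f s (x s) (u s) (σ s) - f s (z s) 0 (σ s)) := by
      rw [intervalIntegral.integral_sub hxi hzi, hx.integral_eq t₁ ht₁ t (hsubD ht),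
        hz.1.integral_eq t₁ ht₁' t (hfwd (mem_Ici.2 ht.1)), hz₁, add_sub_add_left_eq_sub]
    have h2 : ‖x t - z t‖ ≤ ∫ s in t₁..t, ((ε + κ * γ ‖u s‖) + L * ‖x s - z s‖) := by
      rw [h1]
      refine intervalIntegral.norm_integral_le_of_norm_le ht.1 (Eventually.of_forall fun s hs => ?_)
        (hεi.add (hwi.const_mul L))
      exact hpt s ⟨hs.1.le, hs.2.trans ht.2⟩
    rw [intervalIntegral.integral_add hεi (hwi.const_mul L),
      intervalIntegral.integral_add intervalIntegrable_const (hγi.const_mul κ),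
      intervalIntegral.integral_const_mul, intervalIntegral.integral_const_mul,
      intervalIntegral.integral_const, smul_eq_mul] at h2
    have h3 : ∫ s in t₁..t, γ ‖u s‖ ≤ ∫ s in t₁..t₁ + T, γ ‖u s‖ :=
      intervalIntegral.integral_mono_interval le_rfl ht.1 ht.2
        (Eventually.of_forall fun s => hγ.nonneg (norm_nonneg _))
        (hγ.intervalIntegrable_comp_norm hu ht₁0 (by linarith))
    have h4 : (t - t₁) * ε ≤ ε * T := by
      rw [mul_comm]
      exact mul_le_mul_of_nonneg_left (by linarith [ht.2]) hε0.le
    linarith [mul_le_mul_of_nonneg_left h3 hκ]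
  have hgr := le_mul_exp_of_le_add_integral htT hwc hL hbound (t₁ + T) (right_mem_Icc.2 htT)
  rw [add_sub_cancel_left] at hgr
  have hεT : ε * T * Real.exp (L * T) = η := by
    rw [hε]; field_simp
  have h5 := norm_le_norm_add_norm_sub' (x (t₁ + T)) (z (t₁ + T))
  have h6 := hzβ (t₁ + T) htT
  rw [add_sub_cancel_left] at h6
  have h7 : (ε * T + κ * ∫ s in t₁..t₁ + T, γ ‖u s‖) * Real.exp (L * T) =
      η + κ * Real.exp (L * T) * ∫ s in t₁..t₁ + T, γ ‖u s‖ := by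
    rw [add_mul, hεT]; ring
  linarith

/-- Zero-output dissipativity bounds solutions by their initial state and the input energy. -/
lemma ZeroOD.exists_bound (hα : ClassK α) (h : ZeroOD f S α) :
    ∃ ψ ρ, ClassK ψ ∧ ClassK ρ ∧ ∀ t₀, 0 ≤ t₀ → ∀ u : ℝ → F, IsInput u → ∀ σ ∈ S, ∀ D x,
      IsMaximalSolution f u σ D x → t₀ ∈ D → ∀ t ∈ D, t₀ ≤ t →
        ‖x t‖ ≤ ψ ‖x t₀‖ + ρ (∫ s in t₀..t, α ‖u s‖) := by
  obtain ⟨V, -, ⟨φ₁, φ₂, h₁, h₂, hV⟩, hdis⟩ := h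
  obtain ⟨g, hg, hinv⟩ := h₁.exists_inverse
  refine ⟨fun s => g (2 * φ₂ s), fun s => g (2 * s), hg.comp (h₂.1.const_mul two_pos),
    hg.comp (classK_id.const_mul two_pos), fun t₀ ht₀ u hu σ hσ D x hx htD t ht htt => ?_⟩
  refine hg.le_add_of_le_add hinv h₁.1 (norm_nonneg _) (h₂.1.nonneg (norm_nonneg _)) ?_ ?_
  · exact intervalIntegral.integral_nonneg htt fun s _ => hα.nonneg (norm_nonneg _)
  · linarith [hdis t₀ ht₀ u hu σ hσ D x hx htD t ht htt, (hV t (ht₀.trans htt) (x t)).1,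
      (hV t₀ ht₀ (x t₀)).2]

/-- The input energy is monotone in the gain and in the time interval. -/
lemma integral_comp_norm_mono (hα : ClassK α) (hχ : ClassK χ) (hαχ : ∀ s, α s ≤ χ s)
    (hu : IsInput u) {a b a' b' : ℝ} (ha : 0 ≤ a) (haa : a ≤ a') (hab : a' ≤ b') (hbb : b' ≤ b) :
    ∫ s in a'..b', α ‖u s‖ ≤ ∫ s in a..b, χ ‖u s‖ := by
  have ha' : 0 ≤ a' := ha.trans haa
  have hb' : 0 ≤ b' := ha'.trans hab
  calc ∫ s in a'..b', α ‖u s‖ ≤ ∫ s in a'..b', χ ‖u s‖ :=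
        intervalIntegral.integral_mono hab (hα.intervalIntegrable_comp_norm hu ha' hb')
          (hχ.intervalIntegrable_comp_norm hu ha' hb') fun s => hαχ _
    _ ≤ ∫ s in a..b, χ ‖u s‖ :=
        intervalIntegral.integral_mono_interval haa hab hbb
          (Eventually.of_forall fun s => hχ.nonneg (norm_nonneg _))
          (hχ.intervalIntegrable_comp_norm hu ha (hb'.trans hbb))

lemma ZeroOD.forwardComplete (hreg : Regular f) (hγ : ClassK γ) (hC1 : CondC1 f γ)
    (hS : ∀ σ ∈ S, IsSwitchingSignal σ) (hα : ClassK α) (h : ZeroOD f S α) :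
    ForwardComplete f S := by
  obtain ⟨ψ, ρ, hψ, hρ, hb⟩ := h.exists_bound hα
  intro t₀ ht₀ u hu σ hσ D x hx htD
  refine hx.Ici_subset hreg hγ hC1 hu (hS σ hσ) htD fun T =>
    ⟨ψ ‖x t₀‖ + ρ (∫ s in t₀..T, α ‖u s‖), fun t ht htt htT => ?_⟩
  refine (hb t₀ ht₀ u hu σ hσ D x hx htD t ht htt).trans ?_
  gcongr
  exact hρ.mono (intervalIntegral.integral_nonneg htt fun s _ => hα.nonneg (norm_nonneg _))
    (integral_comp_norm_mono hα hα (fun _ => le_rfl) hu ht₀ le_rfl htt htT)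

/-- Uniform attractivity modulo the input energy. -/
lemma exists_time_norm_le (hγ : ClassK γ) (hC1 : CondC1 f γ) (hC2 : CondC2 f) (hC3 : CondC3 f)
    (hFC : ForwardComplete f S) (hGUAS : ZeroGUAS f S) (hα : ClassK α) (hχ : ClassK χ)
    (hαχ : ∀ s, α s ≤ χ s) (hγχ : ∀ s, γ s ≤ χ s) {ψ ρ : ℝ → ℝ} (hψ : ClassK ψ) (hρ : ClassK ρ)
    (hb : ∀ t₀, 0 ≤ t₀ → ∀ u : ℝ → F, IsInput u → ∀ σ ∈ S, ∀ D x,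
      IsMaximalSolution f u σ D x → t₀ ∈ D → ∀ t ∈ D, t₀ ≤ t →
        ‖x t‖ ≤ ψ ‖x t₀‖ + ρ (∫ s in t₀..t, α ‖u s‖)) {r ε : ℝ} (hr : 0 ≤ r) (hε : 0 < ε) :
    ∃ T, 0 ≤ T ∧ ∀ t₀, 0 ≤ t₀ → ∀ u : ℝ → F, IsInput u → ∀ σ ∈ S, ∀ D x,
      IsMaximalSolution f u σ D x → t₀ ∈ D → ‖x t₀‖ ≤ r → ∀ t ∈ D, t₀ + T ≤ t →
        ‖x t‖ ≤ ε + (ρ (∫ s in t₀..t, χ ‖u s‖) + ψ (∫ s in t₀..t, χ ‖u s‖)) := by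
  obtain ⟨β, hβ, hGU⟩ := hGUAS
  obtain ⟨δ, hδ, hψδ⟩ := hψ.exists_pos_le hε
  have hψr := hψ.nonneg hr
  have hρr := hρ.nonneg hr
  set R : ℝ := ψ r + ρ r + 1 with hRdef
  have hR : 0 < R := by positivity
  obtain ⟨T, hβT, hT⟩ : ∃ T, β R T < δ / 3 ∧ 0 < T :=
    (((hβ.2 R hR.le).2.eventually_lt_const (show 0 < δ / 3 by positivity)).and
      (eventually_gt_atTop 0)).exists
  obtain ⟨κ, hκ, hcmp⟩ := exists_norm_le_add_mul_integral hγ hC1 hC2 hC3 hFC hβ hGU hR hT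
    (show 0 < δ / 3 by positivity)
  obtain ⟨k, hk⟩ := exists_nat_ge (κ * r / (δ / 3))
  have hkr : κ * r ≤ ((k + 1 : ℕ) : ℝ) * (δ / 3) := by
    rw [div_le_iff₀ (by positivity)] at hk
    push_cast
    linarith
  refine ⟨((k + 1 : ℕ) : ℝ) * T, by positivity, fun t₀ ht₀ u hu σ hσ D x hx htD hxr t ht htT => ?_⟩
  have hkT : 0 ≤ ((k + 1 : ℕ) : ℝ) * T := by positivity
  have htt : t₀ ≤ t := by linarith
  set e : ℝ := ∫ s in t₀..t, χ ‖u s‖ with he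
  have hαnn : ∀ a b, a ≤ b → 0 ≤ ∫ s in a..b, α ‖u s‖ := fun a b hab =>
    intervalIntegral.integral_nonneg hab fun s _ => hα.nonneg (norm_nonneg _)
  have he0 : 0 ≤ e :=
    intervalIntegral.integral_nonneg htt fun s _ => hχ.nonneg (norm_nonneg _)
  have hαe : ∀ a b, t₀ ≤ a → a ≤ b → b ≤ t → ρ (∫ s in a..b, α ‖u s‖) ≤ ρ e :=
    fun a b h1 h2 h3 => hρ.mono (hαnn a b h2) (integral_comp_norm_mono hα hχ hαχ hu ht₀ h1 h2 h3)
  have hψe := hψ.nonneg he0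
  have hall : ∀ s ∈ D, t₀ ≤ s → s ≤ t → ‖x s‖ ≤ ψ r + ρ e := fun s hs h1 h2 =>
    (hb t₀ ht₀ u hu σ hσ D x hx htD s hs h1).trans
      (add_le_add (hψ.mono (norm_nonneg _) hxr) (hαe t₀ s le_rfl h1 h2))
  rcases le_or_gt r e with hre | hre
  · linarith [hall t ht htt le_rfl, hψ.mono hr hre]
  have hsub : Icc t₀ t ⊆ D := hx.1.ordConnected.out htD ht
  let a : ℕ → ℝ := fun j => t₀ + j * T
  have ha0 : ∀ j, t₀ ≤ a j := fun j => by
    have : 0 ≤ (j : ℝ) * T := by positivity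
    linarith
  have haT : ∀ j, a (j + 1) = a j + T := fun j => by simp only [a]; push_cast; ring
  have hat : ∀ j ≤ k + 1, a j ≤ t := fun j hj => by
    have : (j : ℝ) * T ≤ ((k + 1 : ℕ) : ℝ) * T :=
      mul_le_mul_of_nonneg_right (by exact_mod_cast hj) hT.le
    linarith
  obtain ⟨j, hj, hjle⟩ : ∃ j ∈ Finset.range (k + 1),
      κ * (∫ s in a j..a (j + 1), γ ‖u s‖) ≤ δ / 3 := by
    refine Finset.exists_le_of_sum_le ⟨0, by simp⟩ ?_
    rw [← Finset.mul_sum, intervalIntegral.sum_integral_adjacent_intervals fun j _ =>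
      hγ.intervalIntegrable_comp_norm hu (ht₀.trans (ha0 j)) (ht₀.trans (ha0 (j + 1)))]
    have h1 : ∫ s in a 0..a (k + 1), γ ‖u s‖ ≤ e :=
      integral_comp_norm_mono hγ hχ hγχ hu ht₀ (ha0 0)
        (by simpa [a] using ha0 (k + 1)) (hat (k + 1) le_rfl)
    have h2 := mul_le_mul_of_nonneg_left (h1.trans hre.le) hκ
    simpa using h2.trans hkr
  have hjk : j + 1 ≤ k + 1 := Finset.mem_range.1 hj
  have hs1 : a j ∈ D := hsub ⟨ha0 j, hat j (by omega)⟩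
  have hs2t := hat (j + 1) hjk
  have hs2 : a (j + 1) ∈ D := hsub ⟨ha0 (j + 1), hs2t⟩
  have hδx : ‖x (a (j + 1))‖ ≤ δ := by
    have h1 := hcmp u hu σ hσ D x hx.1 (a j) hs1 (by rw [← haT]; exact hs2) fun s hs => by
      have h2 : t₀ ≤ s := (ha0 j).trans hs.1
      have h3 : s ≤ t := hs.2.trans (by rw [← haT]; exact hs2t)
      have h4 := hall s (hsub ⟨h2, h3⟩) h2 h3
      linarith [hρ.mono he0 hre.le]
    rw [← haT] at h1
    linarith
  have hfin := hb (a (j + 1)) (ht₀.trans (ha0 _)) u hu σ hσ D x hx hs2 t ht hs2t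
  linarith [hψ.mono (norm_nonneg _) hδx, hαe (a (j + 1)) t (ha0 _) hs2t le_rfl]

/-- Finite-energy inputs drive the state of an iISS system to zero. -/
lemma IISS.beics (hχ : ClassK χ) (h : IISS f S χ) : BEICS f S χ := by
  obtain ⟨hFC, β, ρ, hβ, hρ, hest⟩ := h
  intro t₀ ht₀ u hu σ hσ D x hx htD hE
  have hfwd := hFC t₀ ht₀ u hu σ hσ D x hx htD
  refine ⟨hfwd, ?_⟩
  have hint : IntegrableOn (fun s => χ ‖u s‖) (Ioi 0) := by
    refine ⟨(hχ.measurable_comp_norm hu).aestronglyMeasurable, ?_⟩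
    rw [hasFiniteIntegral_iff_ofReal (Eventually.of_forall fun s => hχ.nonneg (norm_nonneg _))]
    exact lt_top_iff_ne_top.2 hE
  have hlim := intervalIntegral_tendsto_integral_Ioi 0 hint tendsto_id
  rw [Metric.tendsto_atTop]
  intro ε hε
  obtain ⟨η, hη, hρη⟩ := hρ.exists_pos_le (show 0 < ε / 2 by positivity)
  obtain ⟨s₁, hs₁⟩ := (Metric.tendsto_atTop.1 hlim) (η / 2) (by positivity)
  set s := max s₁ t₀ with hs
  have hst : t₀ ≤ s := le_max_right _ _
  have hs0 : 0 ≤ s := ht₀.trans hst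
  have hshift : Tendsto (fun t => t - s) atTop atTop := tendsto_atTop_add_const_right _ _ tendsto_id
  have hβlim := ((hβ.2 ‖x s‖ (norm_nonneg _)).2.comp hshift).eventually_lt_const
    (show 0 < ε / 2 by positivity)
  obtain ⟨s₂, hs₂⟩ := eventually_atTop.1 hβlim
  refine ⟨max s₂ s, fun t ht => ?_⟩
  have htS : s ≤ t := (le_max_right _ _).trans ht
  have h1 := hest s hs0 u hu σ hσ D x hx (hfwd hst) t (hfwd (hst.trans htS)) htS
  have h2 : ∫ τ in s..t, χ ‖u τ‖ ≤ η := by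
    have h3 := hs₁ s (le_max_left _ _)
    have h4 := hs₁ t ((le_max_left _ _).trans htS)
    rw [Real.dist_eq, abs_lt] at h3 h4
    simp only [id] at h3 h4
    rw [← intervalIntegral.integral_interval_sub_left
      (hχ.intervalIntegrable_comp_norm hu le_rfl (hs0.trans htS))
      (hχ.intervalIntegrable_comp_norm hu le_rfl hs0)]
    linarith [h3.1, h4.2]
  have h5 := hρ.mono (intervalIntegral.integral_nonneg htS fun s _ =>
    hχ.nonneg (norm_nonneg _)) h2
  have h6 : β ‖x s‖ (t - s) < ε / 2 := hs₂ t ((le_max_left _ _).trans ht)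
  rw [dist_zero_right]
  linarith

lemma iiss_of_zeroGUAS_of_zeroOD (hreg : Regular f) (hS : ∀ σ ∈ S, IsSwitchingSignal σ)
    (hA : AssumptionA f γ) (hα : ClassK α) (hGUAS : ZeroGUAS f S) (hOD : ZeroOD f S α) :
    IISS f S fun s => max (α s) (γ s) := by
  obtain ⟨hγ, hC1, hC2, hC3⟩ := hA
  have hFC := hOD.forwardComplete hreg hγ hC1 hS hα
  obtain ⟨ψ, ρ, hψ, hρ, hb⟩ := hOD.exists_bound hα
  let χ : ℝ → ℝ := fun s => max (α s) (γ s)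
  have hχ : ClassK χ := hα.sup hγ
  have hαχ : ∀ s, α s ≤ χ s := fun s => le_max_left _ _
  have hγχ : ∀ s, γ s ≤ χ s := fun s => le_max_right _ _
  let θ : ℝ → ℝ := fun s => ρ s + ψ s
  let A : Set (ℝ × ℝ × ℝ) := {p | ∃ t₀, 0 ≤ t₀ ∧ ∃ u : ℝ → F, IsInput u ∧ ∃ σ ∈ S, ∃ D x,
    IsMaximalSolution f u σ D x ∧ t₀ ∈ D ∧ ∃ t ∈ D, t₀ ≤ t ∧
      p = (‖x t₀‖, t - t₀, ‖x t‖ - θ (∫ s in t₀..t, χ ‖u s‖))}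
  obtain ⟨β, hβ, hβA⟩ := exists_classKL_bound A hψ
    (by rintro p ⟨t₀, -, u, -, σ, -, D, x, -, -, t, -, -, rfl⟩; exact norm_nonneg _)
    (by
      rintro p ⟨t₀, ht₀, u, hu, σ, hσ, D, x, hx, htD, t, ht, htt, rfl⟩
      have h1 := hb t₀ ht₀ u hu σ hσ D x hx htD t ht htt
      have h2 := hρ.mono (intervalIntegral.integral_nonneg htt fun s _ => hα.nonneg (norm_nonneg _))
        (integral_comp_norm_mono hα hχ hαχ hu ht₀ le_rfl htt le_rfl)
      have h3 : 0 ≤ ψ (∫ s in t₀..t, χ ‖u s‖) :=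
        hψ.nonneg (intervalIntegral.integral_nonneg htt fun s _ => hχ.nonneg (norm_nonneg _))
      simp only [θ]
      linarith)
    (by
      intro r hr ε hε
      obtain ⟨T, -, hT⟩ := exists_time_norm_le hγ hC1 hC2 hC3 hFC hGUAS hα hχ hαχ hγχ hψ hρ hb hr hε
      refine ⟨T, ?_⟩
      rintro p ⟨t₀, ht₀, u, hu, σ, hσ, D, x, hx, htD, t, ht, htt, rfl⟩ hpr hpT
      have h1 := hT t₀ ht₀ u hu σ hσ D x hx htD hpr t ht (by simp only at hpT; linarith)
      simp only [θ]
      linarith)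
  refine ⟨hFC, β, θ, hβ, hρ.add hψ, fun t₀ ht₀ u hu σ hσ D x hx htD t ht htt => ?_⟩
  have h1 := hβA _ ⟨t₀, ht₀, u, hu, σ, hσ, D, x, hx, htD, t, ht, htt, rfl⟩
    (by simp only; linarith)
  simp only at h1
  linarith

end Stability

/-- Theorem 2(a): under Assumption A with `γ` as in (C1), if the system
is 0-GUAS w.r.t. `S` and 0-OD w.r.t. `S` with supply function `α`, then it is iISS w.r.t. `S`
with iISS gain `χ = max {α, γ}` and has the `χ`-BEICS property w.r.t. `S`. -/
theorem stmt12 {n m : ℕ} {Γ : Type*} [Nonempty Γ]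
    (f : ℝ → EuclideanSpace ℝ (Fin n) → EuclideanSpace ℝ (Fin m) → Γ → EuclideanSpace ℝ (Fin n))
    (hreg : Regular f)
    (S : Set (ℝ → Γ)) (hS : ∀ σ ∈ S, IsSwitchingSignal σ)
    (γ : ℝ → ℝ) (hA : AssumptionA f γ)
    (α : ℝ → ℝ) (hα : ClassK α)
    (hGUAS : ZeroGUAS f S) (hOD : ZeroOD f S α) :
    IISS f S (fun s => max (α s) (γ s)) ∧ BEICS f S (fun s => max (α s) (γ s)) := by
  have h := iiss_of_zeroGUAS_of_zeroOD hreg hS hA hα hGUAS hOD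
  exact ⟨h, h.beics (hα.sup hA.1)⟩
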